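/- arXiv:2102.04900 — 4 statements merged into one kernel-verified Lean document; each statement's English description precedes it below -/
import Mathlib

section
/- Let λ₁ and λ₂ be the two eigenvalues of the Hessian matrix D²u₀(y₀). If x₀ ≠ y₀, then for any choice of maximum points x_ε of u_ε one has lim_{ε→0⁺} λ_max(D²u_ε(x_ε)) = max{λ₁, λ₂}. -/
open Real Set Metric Filter Topology

noncomputable section

abbrev E2 := EuclideanSpace ℝ (Fin 2)

/-- Second partial derivative `∂²u/∂xᵢ∂xⱼ` at `x`. -/
noncomputable def pd2 (u : E2 → ℝ) (x : E2) (i j : Fin 2) : ℝ :=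
  fderiv ℝ (fun y => fderiv ℝ u y (EuclideanSpace.single j 1)) x (EuclideanSpace.single i 1)

/-- The Hessian matrix `D²u(x)`. -/
noncomputable def Hess (u : E2 → ℝ) (x : E2) : Matrix (Fin 2) (Fin 2) ℝ :=
  Matrix.of fun i j => pd2 u x i j

/-- The Laplacian `Δu(x)`. -/
noncomputable def lap (u : E2 → ℝ) (x : E2) : ℝ := pd2 u x 0 0 + pd2 u x 1 1

/-- The largest eigenvalue of a symmetric 2×2 real matrix. -/
noncomputable def lambdaMax (M : Matrix (Fin 2) (Fin 2) ℝ) : ℝ :=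
  ((M 0 0 + M 1 1) + Real.sqrt ((M 0 0 - M 1 1) ^ 2 + (M 0 1 + M 1 0) ^ 2)) / 2

/-- `u` is the torsion function of `U`: continuous up to the boundary, `C²` inside,
`Δu = -1` in `U` and `u = 0` on `∂U`. -/
def IsTorsion (U : Set E2) (u : E2 → ℝ) : Prop :=
  ContinuousOn u (closure U) ∧ (∀ x ∈ U, ContDiffAt ℝ 2 u x) ∧
    (∀ x ∈ U, lap u x = -1) ∧ (∀ x ∈ frontier U, u x = 0)


lemma pd2_eq_fderiv_fderiv {u : E2 → ℝ} {x : E2} (hu : ContDiffAt ℝ 2 u x) (i j : Fin 2) :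
    pd2 u x i j =
      fderiv ℝ (fderiv ℝ u) x (EuclideanSpace.single i 1) (EuclideanSpace.single j 1) := by
  have h : DifferentiableAt ℝ (fderiv ℝ u) x :=
    (hu.fderiv_right (m := 1) (by norm_num)).differentiableAt one_ne_zero
  unfold pd2
  rw [fderiv_clm_apply h (by fun_prop)]
  simp

lemma eventually_differentiableAt {u : E2 → ℝ} {x : E2} (hu : ContDiffAt ℝ 2 u x) :
    ∀ᶠ y in 𝓝 x, DifferentiableAt ℝ u y :=
  (hu.eventually (by simp)).mono fun _ hy => hy.differentiableAt two_ne_zero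

lemma differentiableAt_fderiv_apply {u : E2 → ℝ} {x : E2} (hu : ContDiffAt ℝ 2 u x) (v : E2) :
    DifferentiableAt ℝ (fun y => fderiv ℝ u y v) x :=
  ((hu.fderiv_right (m := 1) (by norm_num)).differentiableAt one_ne_zero).clm_apply
    (by fun_prop)

lemma pd2_add {u v : E2 → ℝ} {x : E2} (hu : ContDiffAt ℝ 2 u x) (hv : ContDiffAt ℝ 2 v x)
    (i j : Fin 2) : pd2 (fun y => u y + v y) x i j = pd2 u x i j + pd2 v x i j := by
  have h : (fun y => fderiv ℝ (fun y => u y + v y) y (EuclideanSpace.single j 1)) =ᶠ[𝓝 x]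
      fun y => fderiv ℝ u y (EuclideanSpace.single j 1) +
        fderiv ℝ v y (EuclideanSpace.single j 1) := by
    filter_upwards [eventually_differentiableAt hu, eventually_differentiableAt hv] with y h₁ h₂
    rw [fderiv_fun_add h₁ h₂]
    rfl
  unfold pd2
  rw [h.fderiv_eq, fderiv_fun_add (differentiableAt_fderiv_apply hu _)
    (differentiableAt_fderiv_apply hv _)]
  rfl

lemma pd2_const_mul {u : E2 → ℝ} {x : E2} (hu : ContDiffAt ℝ 2 u x) (c : ℝ)
    (i j : Fin 2) : pd2 (fun y => c * u y) x i j = c * pd2 u x i j := by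
  have h : (fun y => fderiv ℝ (fun y => c * u y) y (EuclideanSpace.single j 1)) =ᶠ[𝓝 x]
      fun y => c * fderiv ℝ u y (EuclideanSpace.single j 1) := by
    filter_upwards [eventually_differentiableAt hu] with y h₁
    rw [fderiv_const_mul h₁]
    rfl
  unfold pd2
  rw [h.fderiv_eq, fderiv_const_mul (differentiableAt_fderiv_apply hu _)]
  rfl

lemma pd2_sub {u v : E2 → ℝ} {x : E2} (hu : ContDiffAt ℝ 2 u x) (hv : ContDiffAt ℝ 2 v x)
    (i j : Fin 2) : pd2 (fun y => u y - v y) x i j = pd2 u x i j - pd2 v x i j := by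
  have h := pd2_add hu ((contDiffAt_const (c := (-1 : ℝ))).mul hv) i j
  rw [pd2_const_mul hv] at h
  rw [sub_eq_add_neg, neg_eq_neg_one_mul, ← h]
  congr 1
  ext y
  ring

lemma lap_add {u v : E2 → ℝ} {x : E2} (hu : ContDiffAt ℝ 2 u x) (hv : ContDiffAt ℝ 2 v x) :
    lap (fun y => u y + v y) x = lap u x + lap v x := by
  simp only [lap, pd2_add hu hv]
  ring

lemma lap_sub {u v : E2 → ℝ} {x : E2} (hu : ContDiffAt ℝ 2 u x) (hv : ContDiffAt ℝ 2 v x) :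
    lap (fun y => u y - v y) x = lap u x - lap v x := by
  simp only [lap, pd2_sub hu hv]
  ring

lemma lap_const_mul {u : E2 → ℝ} {x : E2} (hu : ContDiffAt ℝ 2 u x) (c : ℝ) :
    lap (fun y => c * u y) x = c * lap u x := by
  simp only [lap, pd2_const_mul hu]
  ring

lemma pd2_const (c : ℝ) (x : E2) (i j : Fin 2) : pd2 (fun _ => c) x i j = 0 := by
  simp [pd2]

lemma pd2_self_nonpos_of_isLocalMax {u : E2 → ℝ} {x : E2} (hu : ContDiffAt ℝ 2 u x)
    (hmax : IsLocalMax u x) (i : Fin 2) : pd2 u x i i ≤ 0 := by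
  by_contra! hpos
  set e : E2 := EuclideanSpace.single i 1
  have hline : ∀ t : ℝ, HasDerivAt (fun t : ℝ => x + t • e) e t := fun t => by
    simpa using ((hasDerivAt_id t).smul_const e).const_add x
  have hx0 : x + (0 : ℝ) • e = x := by simp
  have hcont : Tendsto (fun t : ℝ => x + t • e) (𝓝 0) (𝓝 x) := by
    have := (hline 0).continuousAt.tendsto
    rwa [hx0] at this
  have hd : ∀ᶠ t in 𝓝 (0 : ℝ), HasDerivAt (fun t : ℝ => u (x + t • e))
      (fderiv ℝ u (x + t • e) e) t := by
    filter_upwards [hcont.eventually (eventually_differentiableAt hu)] with t ht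
    exact ht.hasFDerivAt.comp_hasDerivAt t (hline t)
  have hd1 : deriv (fun t : ℝ => u (x + t • e)) =ᶠ[𝓝 0] fun t => fderiv ℝ u (x + t • e) e :=
    hd.mono fun t ht => ht.deriv
  have hd2 : deriv (deriv fun t : ℝ => u (x + t • e)) 0 = pd2 u x i i := by
    rw [hd1.deriv_eq]
    have := differentiableAt_fderiv_apply hu e
    rw [← hx0] at this
    have := (this.hasFDerivAt.comp_hasDerivAt (0 : ℝ) (hline 0)).deriv
    rw [hx0] at this
    exact this
  have hlmax : IsLocalMax (fun t : ℝ => u (x + t • e)) 0 := by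
    have := hcont.eventually hmax
    simpa [IsLocalMax, IsMaxFilter] using this
  have hlmin : IsLocalMin (fun t : ℝ => u (x + t • e)) 0 :=
    isLocalMin_of_deriv_deriv_pos (by rw [hd2]; exact hpos) hlmax.deriv_eq_zero
      hd.self_of_nhds.continuousAt
  have hconst : (fun t : ℝ => u (x + t • e)) =ᶠ[𝓝 0] fun _ => u x := by
    filter_upwards [hlmax, hlmin] with t h₁ h₂
    simp only [hx0] at h₁ h₂
    exact le_antisymm h₁ h₂
  have hzero := hconst.deriv.deriv_eq
  simp only [deriv_const', hd2] at hzero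
  exact hpos.ne' hzero

lemma hasFDerivAt_norm_sq_sub (a y : E2) :
    HasFDerivAt (fun z : E2 => ‖z - a‖ ^ 2) (2 • innerSL ℝ (y - a)) y := by
  simpa using ((hasFDerivAt_id y).sub_const a).norm_sq

lemma contDiff_norm_sq_sub (a : E2) : ContDiff ℝ 2 (fun z : E2 => ‖z - a‖ ^ 2) :=
  (contDiff_id.sub contDiff_const).norm_sq ℝ

lemma hasFDerivAt_coord_sub (a y : E2) (i : Fin 2) :
    HasFDerivAt (fun z : E2 => (z - a) i) (EuclideanSpace.proj i : E2 →L[ℝ] ℝ) y :=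
  (EuclideanSpace.proj i : E2 →L[ℝ] ℝ).hasFDerivAt.comp y ((hasFDerivAt_id y).sub_const a)

lemma lap_norm_sq_sub (a x : E2) : lap (fun z : E2 => ‖z - a‖ ^ 2) x = 4 := by
  have h : ∀ i, pd2 (fun z : E2 => ‖z - a‖ ^ 2) x i i = 2 := by
    intro i
    have h1 : (fun y => fderiv ℝ (fun z : E2 => ‖z - a‖ ^ 2) y (EuclideanSpace.single i 1)) =
        fun y => 2 * (y - a) i := by
      ext y
      rw [(hasFDerivAt_norm_sq_sub a y).fderiv]
      simp [EuclideanSpace.inner_single_right]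
    unfold pd2
    rw [h1, ((hasFDerivAt_coord_sub a x i).const_mul 2).fderiv]
    simp
  rw [lap, h, h]
  norm_num

lemma contDiffAt_log_norm_sq_sub {a x : E2} (hx : x ≠ a) :
    ContDiffAt ℝ 2 (fun z : E2 => Real.log (‖z - a‖ ^ 2)) x :=
  (contDiff_norm_sq_sub a).contDiffAt.log (by simpa [sub_eq_zero] using hx)

lemma lap_log_norm_sq_sub {a x : E2} (hx : x ≠ a) :
    lap (fun z : E2 => Real.log (‖z - a‖ ^ 2)) x = 0 := by
  have hne : ∀ y : E2, y ≠ a → ‖y - a‖ ^ 2 ≠ 0 := fun y hy => by simpa [sub_eq_zero] using hy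
  have h : ∀ i, pd2 (fun z : E2 => Real.log (‖z - a‖ ^ 2)) x i i =
      2 / ‖x - a‖ ^ 2 - 4 * ((x - a) i) ^ 2 / (‖x - a‖ ^ 2) ^ 2 := by
    intro i
    have h1 : (fun y => fderiv ℝ (fun z : E2 => Real.log (‖z - a‖ ^ 2)) y
        (EuclideanSpace.single i 1)) =ᶠ[𝓝 x] fun y => 2 * (y - a) i * (‖y - a‖ ^ 2)⁻¹ := by
      filter_upwards [isOpen_ne.mem_nhds hx] with y hy
      rw [((hasFDerivAt_norm_sq_sub a y).log (hne y hy)).fderiv]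
      simp [EuclideanSpace.inner_single_right]
      ring
    unfold pd2
    have h2 : HasFDerivAt (fun y : E2 => (‖y - a‖ ^ 2)⁻¹) _ x :=
      (hasDerivAt_inv (hne x hx)).comp_hasFDerivAt x (hasFDerivAt_norm_sq_sub a x)
    rw [h1.fderiv_eq, (((hasFDerivAt_coord_sub a x i).const_mul 2).fun_mul h2).fderiv]
    have := hne x hx
    simp [EuclideanSpace.inner_single_right]
    field_simp
    ring
  have hs : ‖x - a‖ ^ 2 = ((x - a) 0) ^ 2 + ((x - a) 1) ^ 2 := by
    simp [EuclideanSpace.norm_sq_eq, Fin.sum_univ_two]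
  rw [lap, h, h]
  have := hne x hx
  field_simp
  rw [hs]
  ring

/-- Weak maximum principle for subharmonic functions on bounded open sets. -/
lemma nonpos_of_lap_nonneg {U : Set E2} (hUo : IsOpen U) (hUb : Bornology.IsBounded U)
    {v : E2 → ℝ} (hc : ContinuousOn v (closure U)) (hd : ∀ x ∈ U, ContDiffAt ℝ 2 v x)
    (hl : ∀ x ∈ U, 0 ≤ lap v x) (hf : ∀ x ∈ frontier U, v x ≤ 0) {p : E2} (hp : p ∈ U) :
    v p ≤ 0 := by
  by_contra! hpos
  have hcomp : IsCompact (closure U) := hUb.isCompact_closure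
  obtain ⟨R, hR⟩ := hcomp.isBounded.exists_norm_le
  set δ : ℝ := v p / (2 * (R ^ 2 + 1)) with hδ
  have hδpos : 0 < δ := by positivity
  set φ : E2 → ℝ := fun z => v z + δ * ‖z - 0‖ ^ 2 with hφ
  have hφc : ContinuousOn φ (closure U) := by
    refine hc.add (Continuous.continuousOn ?_)
    fun_prop
  obtain ⟨q, hq, hqmax⟩ := hcomp.exists_isMaxOn ⟨p, subset_closure hp⟩ hφc
  have hqU : q ∈ U := by
    by_contra hqU
    have h1 : v q ≤ 0 := hf q (by rw [hUo.frontier_eq]; exact ⟨hq, hqU⟩)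
    have h2 : v p + δ * ‖p - 0‖ ^ 2 ≤ v q + δ * ‖q - 0‖ ^ 2 := hqmax (subset_closure hp)
    have h3 : ‖q - 0‖ ^ 2 ≤ R ^ 2 := by
      rw [sub_zero]
      exact pow_le_pow_left₀ (norm_nonneg _) (hR q hq) 2
    have h4 : δ * ‖q - 0‖ ^ 2 ≤ δ * (R ^ 2 + 1) := by
      gcongr
      linarith
    have h5 : δ * (R ^ 2 + 1) = v p / 2 := by
      rw [hδ]
      field_simp
    have h6 : 0 ≤ δ * ‖p - 0‖ ^ 2 := by positivity
    linarith
  have hsq : ContDiffAt ℝ 2 (fun z : E2 => δ * ‖z - 0‖ ^ 2) q :=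
    contDiffAt_const.mul (contDiff_norm_sq_sub 0).contDiffAt
  have hlm : IsLocalMax φ q :=
    (hqmax.on_subset subset_closure).isLocalMax (hUo.mem_nhds hqU)
  have hφd : ContDiffAt ℝ 2 φ q := (hd q hqU).add hsq
  have e1 : lap φ q = lap v q + δ * 4 := by
    rw [hφ, lap_add (hd q hqU) hsq, lap_const_mul (contDiff_norm_sq_sub 0).contDiffAt,
      lap_norm_sq_sub]
  have e2 : lap φ q ≤ 0 :=
    add_nonpos (pd2_self_nonpos_of_isLocalMax hφd hlm 0) (pd2_self_nonpos_of_isLocalMax hφd hlm 1)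
  have := hl q hqU
  linarith

lemma harmonicOnNhd_comp_isometry (T : ℂ ≃ₗᵢ[ℝ] E2) (hT1 : T 1 = EuclideanSpace.single 0 1)
    (hTI : T Complex.I = EuclideanSpace.single 1 1) {w : E2 → ℝ} {p : ℂ} {r : ℝ}
    (hd : ∀ x ∈ ball (T p) r, ContDiffAt ℝ 2 w x) (hl : ∀ x ∈ ball (T p) r, lap w x = 0) :
    InnerProductSpace.HarmonicOnNhd (w ∘ T) (ball p r) := by
  have hmem : ∀ z ∈ ball p r, T z ∈ ball (T p) r := fun z hz => by
    simpa [mem_ball, T.dist_map] using hz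
  intro z hz
  refine ⟨(hd _ (hmem z hz)).comp z T.toContinuousLinearEquiv.contDiff.contDiffAt, ?_⟩
  filter_upwards [isOpen_ball.mem_nhds hz] with y hy
  have hy' := hd _ (hmem y hy)
  have h1 : fderiv ℝ (w ∘ T) = fun z => (fderiv ℝ w (T z)).comp (T : ℂ →L[ℝ] E2) := by
    ext1 z
    exact T.toContinuousLinearEquiv.comp_right_fderiv
  have hD : DifferentiableAt ℝ (fderiv ℝ w) (T y) :=
    (hy'.fderiv_right (m := 1) (by norm_num)).differentiableAt one_ne_zero
  have h2 : ∀ a : ℂ, fderiv ℝ (fderiv ℝ (w ∘ T)) y a a =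
      fderiv ℝ (fderiv ℝ w) (T y) (T a) (T a) := by
    intro a
    have h3 : HasFDerivAt (fun z => fderiv ℝ w (T z))
        ((fderiv ℝ (fderiv ℝ w) (T y)).comp (T : ℂ →L[ℝ] E2)) y :=
      hD.hasFDerivAt.comp y (T : ℂ →L[ℝ] E2).hasFDerivAt
    rw [h1, (h3.clm_comp (hasFDerivAt_const _ _)).fderiv]
    simp
  have := hl _ (hmem y hy)
  rw [lap, pd2_eq_fderiv_fderiv hy', pd2_eq_fderiv_fderiv hy', ← hT1, ← hTI] at this
  simp [InnerProductSpace.laplacian_eq_iteratedFDeriv_complexPlane, iteratedFDeriv_two_apply, h2,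
    this]

lemma norm_deriv_deriv_le_of_abs_re_le {F : ℂ → ℂ} {p : ℂ} {r η : ℝ} (hr : 0 < r) (hη : 0 < η)
    (hF : DifferentiableOn ℂ F (ball p r)) (hb : ∀ z ∈ ball p r, |(F z).re| ≤ η) :
    ‖deriv (deriv F) p‖ ≤ 16 * exp 2 * η / r ^ 2 := by
  have hball : ∀ z ∈ closedBall p (r / 4), closedBall z (r / 4) ⊆ ball p r := fun z hz =>
    (closedBall_subset_closedBall' (ε₂ := r / 2) (by
      have := mem_closedBall.1 hz; linarith)).trans (closedBall_subset_ball (by linarith))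
  have h1 : ∀ z ∈ closedBall p (r / 4), ‖deriv F z‖ ≤ 4 * exp 2 * η / r := by
    intro z hz
    have hzr : z ∈ ball p r := hball z hz (mem_closedBall_self (by positivity))
    have hFz : HasDerivAt F (deriv F z) z :=
      (hF.differentiableAt (isOpen_ball.mem_nhds hzr)).hasDerivAt
    have hG : DifferentiableOn ℂ (fun z => Complex.exp ((η : ℂ)⁻¹ * F z)) (ball p r) :=
      (hF.const_mul _).cexp
    have hre : ∀ z, ((η : ℂ)⁻¹ * F z).re = (F z).re / η := fun z => by
      rw [← Complex.ofReal_inv, Complex.re_ofReal_mul]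
      ring
    have hle := Complex.norm_deriv_le_of_forall_mem_sphere_norm_le (c := z) (R := r / 4)
      (C := exp 1) (by positivity) ((hG.mono (hball z hz)).diffContOnCl_ball subset_rfl) (by
        intro y hy
        rw [Complex.norm_exp, hre, Real.exp_le_exp, div_le_one hη]
        exact (le_abs_self _).trans (hb y (hball z hz (sphere_subset_closedBall hy))))
    rw [((hFz.const_mul _).cexp).deriv, norm_mul, norm_mul, Complex.norm_exp, hre, norm_inv,
      Complex.norm_real, Real.norm_of_nonneg hη.le] at hle
    have hlow : exp (-1) ≤ exp ((F z).re / η) := by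
      rw [Real.exp_le_exp, le_div_iff₀ hη]
      linarith [neg_abs_le (F z).re, hb z hzr]
    have h2 : exp (-1) * (η⁻¹ * ‖deriv F z‖) ≤ exp 1 / (r / 4) :=
      (mul_le_mul_of_nonneg_right hlow (by positivity)).trans hle
    have h3 : exp 2 = exp 1 * exp 1 := by rw [← Real.exp_add]; norm_num
    rw [Real.exp_neg] at h2
    have he := Real.exp_pos 1
    rw [h3]
    field_simp at h2 ⊢
    linarith
  have hF' : DifferentiableOn ℂ (deriv F) (ball p r) := hF.deriv isOpen_ball
  have hle := Complex.norm_deriv_le_of_forall_mem_sphere_norm_le (c := p) (R := r / 4)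
    (C := 4 * exp 2 * η / r) (by positivity)
    ((hF'.mono (hball p (mem_closedBall_self (by positivity)))).diffContOnCl_ball subset_rfl)
    fun z hz => h1 z (sphere_subset_closedBall hz)
  refine hle.trans_eq ?_
  field_simp
  norm_num

lemma abs_pd2_le_of_lap_eq_zero {w : E2 → ℝ} {p : E2} {r η : ℝ} (hr : 0 < r) (hη : 0 < η)
    (hd : ∀ x ∈ ball p r, ContDiffAt ℝ 2 w x) (hl : ∀ x ∈ ball p r, lap w x = 0)
    (hb : ∀ x ∈ ball p r, |w x| ≤ η) (i j : Fin 2) :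
    |pd2 w p i j| ≤ 16 * exp 2 * η / r ^ 2 := by
  set T : ℂ ≃ₗᵢ[ℝ] E2 := Complex.orthonormalBasisOneI.repr with hT
  have hT1 : T 1 = EuclideanSpace.single 0 1 := by
    simpa using Complex.orthonormalBasisOneI.repr_self 0
  have hTI : T Complex.I = EuclideanSpace.single 1 1 := by
    simpa using Complex.orthonormalBasisOneI.repr_self 1
  obtain ⟨q, rfl⟩ := T.surjective p
  have hmem : ∀ z ∈ ball q r, T z ∈ ball (T q) r := fun z hz => by
    simpa [mem_ball, T.dist_map] using hz
  have hmem' : ∀ x ∈ ball (T q) r, T.symm x ∈ ball q r := fun x hx => by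
    rw [mem_ball, ← T.dist_map, T.apply_symm_apply]
    exact hx
  obtain ⟨F, hF, hFw⟩ :=
    (harmonicOnNhd_comp_isometry T hT1 hTI hd hl).exists_analyticOnNhd_ball_re_eq
  have hFd : DifferentiableOn ℂ F (ball q r) := hF.differentiableOn
  have hF'd : DifferentiableOn ℂ (deriv F) (ball q r) := hFd.deriv isOpen_ball
  have hbd := norm_deriv_deriv_le_of_abs_re_le hr hη hFd fun z hz => by
    have h := hFw hz
    simp only [Function.comp_apply] at h
    rw [h]
    exact hb _ (hmem z hz)
  have hS : ∀ x, HasFDerivAt (fun x => T.symm x) (T.symm : E2 →L[ℝ] ℂ) x := fun x =>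
    (T.symm : E2 →L[ℝ] ℂ).hasFDerivAt
  have hre : ∀ {G : ℂ → ℂ}, DifferentiableOn ℂ G (ball q r) → ∀ x ∈ ball (T q) r, ∀ c v : E2,
      HasFDerivAt (fun y => (G (T.symm y) * T.symm c).re)
        (Complex.reCLM.comp (T.symm c • ((deriv G (T.symm x)) • (T.symm : E2 →L[ℝ] ℂ)))) x := by
    intro G hG x hx c v
    have h1 : HasDerivAt G (deriv G (T.symm x)) (T.symm x) :=
      (hG.differentiableAt (isOpen_ball.mem_nhds (hmem' x hx))).hasDerivAt
    exact Complex.reCLM.hasFDerivAt.comp x ((h1.comp_hasFDerivAt_of_eq x (hS x) rfl).mul_const _)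
  have hw1 : ∀ x ∈ ball (T q) r, ∀ v : E2, fderiv ℝ w x v =
      (deriv F (T.symm x) * T.symm v).re := by
    intro x hx v
    have hEq : w =ᶠ[𝓝 x] fun y => (F (T.symm y) * T.symm (T 1)).re := by
      filter_upwards [isOpen_ball.mem_nhds hx] with y hy
      have := hFw (hmem' y hy)
      simpa using this.symm
    rw [hEq.fderiv_eq, (hre hFd x hx (T 1) v).fderiv]
    simp
  have hTq : T q ∈ ball (T q) r := mem_ball_self hr
  have hw2 : pd2 w (T q) i j =
      (T.symm (EuclideanSpace.single j 1) * (deriv (deriv F) q *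
        T.symm (EuclideanSpace.single i 1))).re := by
    have hEq : (fun y => fderiv ℝ w y (EuclideanSpace.single j 1)) =ᶠ[𝓝 (T q)]
        fun y => (deriv F (T.symm y) * T.symm (EuclideanSpace.single j 1)).re := by
      filter_upwards [isOpen_ball.mem_nhds hTq] with y hy
      exact hw1 y hy _
    unfold pd2
    rw [hEq.fderiv_eq, (hre hF'd (T q) hTq _ 0).fderiv]
    simp
  rw [hw2]
  refine (Complex.abs_re_le_norm _).trans (le_trans (le_of_eq ?_) hbd)
  rw [norm_mul, norm_mul, T.symm.norm_map, T.symm.norm_map]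
  simp

lemma lambdaMax_eq_max {M : Matrix (Fin 2) (Fin 2) ℝ} {l₁ l₂ : ℝ} (hsymm : M 0 1 = M 1 0)
    (htr : M 0 0 + M 1 1 = l₁ + l₂) (hdet : M 0 0 * M 1 1 - M 0 1 * M 1 0 = l₁ * l₂) :
    lambdaMax M = max l₁ l₂ := by
  have h : (M 0 0 - M 1 1) ^ 2 + (M 0 1 + M 1 0) ^ 2 = (l₁ - l₂) ^ 2 := by
    rw [hsymm] at hdet ⊢
    linear_combination (M 0 0 + M 1 1 + (l₁ + l₂)) * htr - 4 * hdet
  rw [lambdaMax, h, htr, Real.sqrt_sq_eq_abs]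
  rcases le_total l₁ l₂ with h | h
  · rw [max_eq_right h, abs_of_nonpos (by linarith)]
    ring
  · rw [max_eq_left h, abs_of_nonneg (by linarith)]
    ring

lemma tendsto_lambdaMax {ι : Type*} {l : Filter ι} {A : ι → Matrix (Fin 2) (Fin 2) ℝ}
    {M : Matrix (Fin 2) (Fin 2) ℝ} (h : ∀ i j, Tendsto (fun t => A t i j) l (𝓝 (M i j))) :
    Tendsto (fun t => lambdaMax (A t)) l (𝓝 (lambdaMax M)) := by
  have hs := (((h 0 0).sub (h 1 1)).pow 2).add (((h 0 1).add (h 1 0)).pow 2)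
  exact (((h 0 0).add (h 1 1)).add ((Real.continuous_sqrt.tendsto _).comp hs)).div_const 2

lemma Hess_symm {u : E2 → ℝ} {x : E2} (hu : ContDiffAt ℝ 2 u x) (i j : Fin 2) :
    Hess u x i j = Hess u x j i := by
  have := (hu.isSymmSndFDerivAt (by simp)) (EuclideanSpace.single i 1) (EuclideanSpace.single j 1)
  simpa [Hess, pd2_eq_fderiv_fderiv hu] using this

lemma continuousAt_pd2 {u : E2 → ℝ} {x : E2} (hu : ContDiffAt ℝ 2 u x) (i j : Fin 2) :
    ContinuousAt (fun y => pd2 u y i j) x := by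
  have h1 : ContDiffAt ℝ 1 (fderiv ℝ u) x := hu.fderiv_right (by norm_num)
  have h2 : ContinuousAt (fderiv ℝ (fderiv ℝ u)) x :=
    (h1.fderiv_right (m := 0) (by norm_num)).continuousAt
  have h3 : (fun y => pd2 u y i j) =ᶠ[𝓝 x] fun y =>
      fderiv ℝ (fderiv ℝ u) y (EuclideanSpace.single i 1) (EuclideanSpace.single j 1) := by
    filter_upwards [hu.eventually (by simp)] with y hy
    exact pd2_eq_fderiv_fderiv hy i j
  exact (continuousAt_congr h3).2 ((h2.clm_apply continuousAt_const).clm_apply continuousAt_const)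

lemma isOpen_diff_closedBall {Ω : Set E2} (hΩ : IsOpen Ω) (a : E2) (ε : ℝ) :
    IsOpen (Ω \ closedBall a ε) :=
  hΩ.sdiff isClosed_closedBall

lemma closure_diff_closedBall_subset (Ω : Set E2) (a : E2) (ε : ℝ) {x : E2}
    (hx : x ∈ closure (Ω \ closedBall a ε)) : x ∈ closure Ω ∧ ε ≤ dist x a := by
  refine ⟨closure_mono sdiff_subset hx, ?_⟩
  have hcl : IsClosed {y : E2 | ε ≤ dist y a} :=
    isClosed_le continuous_const (continuous_id.dist continuous_const)
  refine closure_minimal (fun y hy => ?_) hcl hx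
  have := hy.2
  rw [mem_closedBall, not_le] at this
  exact this.le

lemma mem_frontier_diff_closedBall {Ω : Set E2} (hΩ : IsOpen Ω) {a : E2} {ε : ℝ} {x : E2}
    (hx : x ∈ frontier (Ω \ closedBall a ε)) :
    x ∈ frontier Ω ∨ (x ∈ Ω ∧ dist x a = ε) := by
  rw [(isOpen_diff_closedBall hΩ a ε).frontier_eq] at hx
  obtain ⟨h1, h2⟩ := closure_diff_closedBall_subset Ω a ε hx.1
  by_cases hxΩ : x ∈ Ω
  · right
    refine ⟨hxΩ, le_antisymm ?_ h2⟩
    by_contra hlt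
    exact hx.2 ⟨hxΩ, by rwa [mem_closedBall]⟩
  · left
    rw [hΩ.frontier_eq]
    exact ⟨h1, hxΩ⟩

lemma IsTorsion.nonneg_of_mem_closure {Ω : Set E2} {u : E2 → ℝ} (hΩ : IsOpen Ω)
    (hu : IsTorsion Ω u) (hpos : ∀ x ∈ Ω, 0 < u x) {x : E2} (hx : x ∈ closure Ω) : 0 ≤ u x := by
  by_cases hxΩ : x ∈ Ω
  · exact (hpos x hxΩ).le
  · exact (hu.2.2.2 x (by rw [hΩ.frontier_eq]; exact ⟨hx, hxΩ⟩)).ge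

lemma torsion_diff_closedBall_le {Ω : Set E2} (hΩo : IsOpen Ω) (hΩb : Bornology.IsBounded Ω)
    {u v : E2 → ℝ} (hu : IsTorsion Ω u) (hpos : ∀ x ∈ Ω, 0 < u x) {a : E2} {ε : ℝ}
    (hv : IsTorsion (Ω \ closedBall a ε) v) {x : E2} (hx : x ∈ Ω \ closedBall a ε) :
    v x ≤ u x := by
  have h := nonpos_of_lap_nonneg (v := fun y => v y - u y) (isOpen_diff_closedBall hΩo a ε)
    (hΩb.subset sdiff_subset) (hv.1.sub (hu.1.mono (closure_mono sdiff_subset)))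
    (fun y hy => (hv.2.1 y hy).sub (hu.2.1 y hy.1))
    (fun y hy => by
      rw [lap_sub (hv.2.1 y hy) (hu.2.1 y hy.1), hv.2.2.1 y hy, hu.2.2.1 y hy.1, sub_self])
    (fun y hy => by
      have := hu.nonneg_of_mem_closure hΩo hpos
        (closure_diff_closedBall_subset Ω a ε (frontier_subset_closure hy)).1
      simp only [hv.2.2.2 y hy]
      linarith) hx
  simpa using h

lemma torsion_sub_le_log {Ω : Set E2} (hΩo : IsOpen Ω) (hΩb : Bornology.IsBounded Ω)
    {u v : E2 → ℝ} (hu : IsTorsion Ω u) {a : E2} {ε D M : ℝ} (hε : 0 < ε) (hεD : ε < D)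
    (hD : ∀ x ∈ closure Ω, dist x a ≤ D) (hM0 : 0 ≤ M) (hM : ∀ x ∈ Ω, u x ≤ M)
    (hv : IsTorsion (Ω \ closedBall a ε) v) {x : E2} (hx : x ∈ Ω \ closedBall a ε) :
    u x - v x ≤ M / (Real.log (D ^ 2) - Real.log (ε ^ 2)) *
      (Real.log (D ^ 2) - Real.log (‖x - a‖ ^ 2)) := by
  set K := M / (Real.log (D ^ 2) - Real.log (ε ^ 2)) with hK
  have hden : 0 < Real.log (D ^ 2) - Real.log (ε ^ 2) :=
    sub_pos.2 (Real.log_lt_log (by positivity) (by gcongr))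
  have hK0 : 0 ≤ K := by positivity
  set h : E2 → ℝ := fun y => K * (Real.log (D ^ 2) - Real.log (‖y - a‖ ^ 2)) with hh
  have hne : ∀ y ∈ closure (Ω \ closedBall a ε), y ≠ a := by
    rintro y hy rfl
    have := (closure_diff_closedBall_subset Ω y ε hy).2
    rw [dist_self] at this
    linarith
  have hlogd : ∀ y, y ≠ a →
      ContDiffAt ℝ 2 (fun y => Real.log (D ^ 2) - Real.log (‖y - a‖ ^ 2)) y := fun y hy =>
    contDiffAt_const.sub (contDiffAt_log_norm_sq_sub hy)
  have hhd : ∀ y, y ≠ a → ContDiffAt ℝ 2 h y := fun y hy => contDiffAt_const.mul (hlogd y hy)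
  have hhl : ∀ y, y ≠ a → lap h y = 0 := fun y hy => by
    rw [hh, lap_const_mul (hlogd y hy), lap_sub contDiffAt_const (contDiffAt_log_norm_sq_sub hy),
      lap_log_norm_sq_sub hy]
    simp [lap, pd2_const]
  have hle := nonpos_of_lap_nonneg (v := fun y => (u y - v y) - h y)
    (isOpen_diff_closedBall hΩo a ε) (hΩb.subset sdiff_subset)
    (((hu.1.mono (closure_mono sdiff_subset)).sub hv.1).sub
      fun y hy => (hhd y (hne y hy)).continuousAt.continuousWithinAt)
    (fun y hy => ((hu.2.1 y hy.1).sub (hv.2.1 y hy)).sub (hhd y (hne y (subset_closure hy))))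
    (fun y hy => by
      have hya := hne y (subset_closure hy)
      rw [lap_sub ((hu.2.1 y hy.1).sub (hv.2.1 y hy)) (hhd y hya),
        lap_sub (hu.2.1 y hy.1) (hv.2.1 y hy), hv.2.2.1 y hy, hu.2.2.1 y hy.1, hhl y hya]
      norm_num)
    (fun y hy => by
      have hyc := frontier_subset_closure hy
      have hv0 : v y = 0 := hv.2.2.2 y hy
      rcases mem_frontier_diff_closedBall hΩo hy with h1 | ⟨h1, h2⟩
      · have hu0 : u y = 0 := hu.2.2.2 y h1
        have h3 : ‖y - a‖ ≤ D := by
          rw [← dist_eq_norm]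
          exact hD y (frontier_subset_closure h1)
        have h4 : 0 < ‖y - a‖ := norm_pos_iff.2 (sub_ne_zero.2 (hne y hyc))
        have h5 : 0 ≤ h y := mul_nonneg hK0
          (sub_nonneg.2 (Real.log_le_log (by positivity) (by gcongr)))
        simp only [hu0, hv0]
        linarith
      · have h3 : h y = M := by
          simp only [hh, hK, ← dist_eq_norm, h2]
          field_simp
        simp only [hv0, h3]
        linarith [hM y h1]) hx
  simp only [hh] at hle
  linarith

lemma IsTorsion.lt_of_ne_critical {Ω : Set E2} (hΩo : IsOpen Ω) {u : E2 → ℝ}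
    (hu : IsTorsion Ω u) (hpos : ∀ x ∈ Ω, 0 < u x) {y : E2} (hy : y ∈ Ω)
    (huniq : ∀ x ∈ Ω, gradient u x = 0 → x = y) (hmax : IsMaxOn u Ω y)
    {x : E2} (hx : x ∈ closure Ω) (hxy : x ≠ y) : u x < u y := by
  by_cases hxΩ : x ∈ Ω
  · refine lt_of_le_of_ne (hmax hxΩ) fun heq => hxy (huniq x hxΩ ?_)
    have hmx : IsMaxOn u Ω x := fun z hz => (hmax hz).trans_eq heq.symm
    rw [gradient, (hmx.isLocalMax (hΩo.mem_nhds hxΩ)).fderiv_eq_zero, map_zero]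
  · rw [hu.2.2.2 x (by rw [hΩo.frontier_eq]; exact ⟨hx, hxΩ⟩)]
    exact hpos y hy

lemma tendsto_div_log_sub_log_sq (M c : ℝ) :
    Tendsto (fun ε : ℝ => M / (c - Real.log (ε ^ 2))) (𝓝[>] 0) (𝓝 0) := by
  refine Tendsto.div_atTop tendsto_const_nhds ?_
  have h : Tendsto (fun ε : ℝ => Real.log (ε ^ 2)) (𝓝[>] 0) atBot := by
    simp only [Real.log_pow]
    exact Real.tendsto_log_nhdsGT_zero.const_mul_atBot (by norm_num)
  simpa [sub_eq_add_neg] using tendsto_atTop_add_const_left _ c (tendsto_neg_atBot_atTop.comp h)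

/-- If `u` attains its maximum over the compact set `K` only at `y`, then every family in `K` along
which `u` tends to the maximum converges to `y`. -/
lemma tendsto_of_tendsto_max {ι : Type*} {l : Filter ι} {K : Set E2} (hK : IsCompact K)
    {u : E2 → ℝ} (hu : ContinuousOn u K) {y : E2} (hlt : ∀ x ∈ K, x ≠ y → u x < u y)
    {x : ι → E2} (hx : ∀ᶠ t in l, x t ∈ K) (hux : ∀ m < u y, ∀ᶠ t in l, m < u (x t)) :
    Tendsto x l (𝓝 y) := by
  rw [Metric.tendsto_nhds]
  intro δ hδ
  have hKc : IsCompact (K \ ball y δ) := hK.diff isOpen_ball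
  rcases (K \ ball y δ).eq_empty_or_nonempty with h | h
  · filter_upwards [hx] with t ht
    by_contra hd
    exact h.subset ⟨ht, hd⟩
  · obtain ⟨q, hq, hqm⟩ := hKc.exists_isMaxOn h (hu.mono sdiff_subset)
    have hqy : q ≠ y := fun he => hq.2 (he ▸ mem_ball_self hδ)
    filter_upwards [hx, hux _ (hlt q hq.1 hqy)] with t ht hm
    by_contra hd
    exact absurd (hqm ⟨ht, hd⟩) (not_le.2 hm)

/-- If `x₀ ≠ y₀`, the largest eigenvalue of the Hessian of `u_ε` at its maximum point
converges to `max λ₁ λ₂`, where `λ₁, λ₂` are the eigenvalues of `D²u₀(y₀)`. -/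
theorem spectral_gap_limit_of_ne
    (Ω : Set E2) (hΩo : IsOpen Ω) (hΩb : Bornology.IsBounded Ω) (hΩc : Convex ℝ Ω)
    (u₀ : E2 → ℝ) (h₀ : IsTorsion Ω u₀) (h₀pos : ∀ x ∈ Ω, 0 < u₀ x)
    (y₀ : E2) (hy₀ : y₀ ∈ Ω) (hy₀crit : gradient u₀ y₀ = 0)
    (hy₀uniq : ∀ x ∈ Ω, gradient u₀ x = 0 → x = y₀)
    (hy₀max : IsMaxOn u₀ Ω y₀)
    (x₀ : E2) (hx₀ : x₀ ∈ Ω) (hne : x₀ ≠ y₀)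
    (l₁ l₂ : ℝ)
    (htr : Hess u₀ y₀ 0 0 + Hess u₀ y₀ 1 1 = l₁ + l₂)
    (hdet : Hess u₀ y₀ 0 0 * Hess u₀ y₀ 1 1 - Hess u₀ y₀ 0 1 * Hess u₀ y₀ 1 0 = l₁ * l₂)
    (ε₁ : ℝ) (hε₁ : 0 < ε₁) (hball : closedBall x₀ ε₁ ⊆ Ω)
    (uε : ℝ → E2 → ℝ) (xε : ℝ → E2)
    (huε : ∀ ε ∈ Ioo (0:ℝ) ε₁, IsTorsion (Ω \ closedBall x₀ ε) (uε ε))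
    (hxε : ∀ ε ∈ Ioo (0:ℝ) ε₁, xε ε ∈ Ω \ closedBall x₀ ε ∧
      IsMaxOn (uε ε) (Ω \ closedBall x₀ ε) (xε ε)) :
    Tendsto (fun ε => lambdaMax (Hess (uε ε) (xε ε))) (𝓝[>] (0:ℝ))
      (𝓝 (max l₁ l₂)) := by
  have hu₀ : ContDiffAt ℝ 2 u₀ y₀ := h₀.2.1 y₀ hy₀
  rw [← lambdaMax_eq_max (Hess_symm hu₀ 0 1) htr hdet]
  have hM : 0 < u₀ y₀ := h₀pos y₀ hy₀
  have hcomp : IsCompact (closure Ω) := hΩb.isCompact_closure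
  obtain ⟨D, hDdist⟩ : ∃ D, ∀ x ∈ closure Ω, dist x x₀ ≤ D := by
    obtain ⟨D, hD⟩ := hcomp.isBounded.subset_closedBall x₀
    exact ⟨D, fun x hx => hD hx⟩
  have hd : 0 < dist y₀ x₀ := dist_pos.2 hne.symm
  have hdD : dist y₀ x₀ ≤ D := hDdist y₀ (subset_closure hy₀)
  obtain ⟨s, hs, hsΩ⟩ := Metric.isOpen_iff.1 hΩo y₀ hy₀
  obtain ⟨ρ, hρ, hρs, hρd⟩ : ∃ ρ : ℝ, 0 < ρ ∧ 2 * ρ ≤ s ∧ 4 * ρ ≤ dist y₀ x₀ :=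
    ⟨min (s / 2) (dist y₀ x₀ / 4), by positivity, by linarith [min_le_left (s / 2) (dist y₀ x₀ / 4)],
      by linarith [min_le_right (s / 2) (dist y₀ x₀ / 4)]⟩
  set C : ℝ := Real.log (D ^ 2) - Real.log ((2 * ρ) ^ 2) with hC
  have hCpos : 0 < C := sub_pos.2 (Real.log_lt_log (by positivity) (by gcongr; linarith))
  set η : ℝ → ℝ := fun ε => u₀ y₀ / (Real.log (D ^ 2) - Real.log (ε ^ 2)) * C with hη
  have hηlim : Tendsto η (𝓝[>] 0) (𝓝 0) := by
    have h := (tendsto_div_log_sub_log_sq (u₀ y₀) (Real.log (D ^ 2))).mul_const C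
    rwa [zero_mul] at h
  have hsmall : ∀ᶠ ε in 𝓝[>] (0 : ℝ), ε ∈ Ioo 0 (min ε₁ ρ) :=
    Ioo_mem_nhdsGT (by positivity)
  have hfar : ∀ x ∈ ball y₀ (2 * ρ), 2 * ρ ≤ dist x x₀ := fun x hx => by
    have h1 := dist_triangle_left y₀ x₀ x
    have h2 := mem_ball.1 hx
    linarith
  have hηpos : ∀ ε ∈ Ioo 0 (min ε₁ ρ), 0 < η ε := fun ε hε => by
    have h1 : ε < ρ := hε.2.trans_le (min_le_right _ _)
    have h2 : 0 < Real.log (D ^ 2) - Real.log (ε ^ 2) :=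
      sub_pos.2 (Real.log_lt_log (pow_pos hε.1 2) (pow_lt_pow_left₀ (by linarith) hε.1.le two_ne_zero))
    positivity
  have hmem : ∀ ε ∈ Ioo 0 (min ε₁ ρ), ∀ x ∈ ball y₀ (2 * ρ), x ∈ Ω \ closedBall x₀ ε :=
    fun ε hε x hx => ⟨hsΩ (ball_subset_ball hρs hx), by
      have h1 : ε < ρ := hε.2.trans_le (min_le_right _ _)
      rw [mem_closedBall, not_le]
      linarith [hfar x hx]⟩
  have hI : ∀ ε ∈ Ioo 0 (min ε₁ ρ), ε ∈ Ioo 0 ε₁ := fun ε hε =>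
    ⟨hε.1, hε.2.trans_le (min_le_left _ _)⟩
  have hbound : ∀ ε ∈ Ioo 0 (min ε₁ ρ), ∀ x ∈ ball y₀ (2 * ρ), |u₀ x - uε ε x| ≤ η ε := by
    intro ε hε x hx
    have h1 : ε < ρ := hε.2.trans_le (min_le_right _ _)
    have hlow := torsion_diff_closedBall_le hΩo hΩb h₀ h₀pos (huε ε (hI ε hε)) (hmem ε hε x hx)
    have hup := torsion_sub_le_log hΩo hΩb h₀ hε.1 (by linarith) hDdist hM.le
      (fun z hz => hy₀max hz) (huε ε (hI ε hε)) (hmem ε hε x hx)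
    have hK : 0 ≤ u₀ y₀ / (Real.log (D ^ 2) - Real.log (ε ^ 2)) :=
      (pos_of_mul_pos_left (hηpos ε hε) hCpos.le).le
    have hlog : Real.log ((2 * ρ) ^ 2) ≤ Real.log (‖x - x₀‖ ^ 2) := by
      refine Real.log_le_log (by positivity) ?_
      rw [← dist_eq_norm]
      exact pow_le_pow_left₀ (by positivity) (hfar x hx) 2
    rw [abs_of_nonneg (sub_nonneg.2 hlow)]
    exact hup.trans (mul_le_mul_of_nonneg_left (sub_le_sub_left hlog _) hK)
  have hxlim : Tendsto xε (𝓝[>] 0) (𝓝 y₀) := by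
    refine tendsto_of_tendsto_max hcomp h₀.1
      (fun x hx hxy => h₀.lt_of_ne_critical hΩo h₀pos hy₀ hy₀uniq hy₀max hx hxy) ?_ ?_
    · filter_upwards [hsmall] with ε hε
      exact subset_closure (hxε ε (hI ε hε)).1.1
    · intro m hm
      filter_upwards [hsmall, hηlim.eventually_lt_const (sub_pos.2 hm)] with ε hε hηε
      have hy : y₀ ∈ ball y₀ (2 * ρ) := mem_ball_self (by positivity)
      have h1 := torsion_diff_closedBall_le hΩo hΩb h₀ h₀pos (huε ε (hI ε hε)) (hxε ε (hI ε hε)).1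
      have h2 : uε ε y₀ ≤ uε ε (xε ε) := (hxε ε (hI ε hε)).2 (hmem ε hε y₀ hy)
      have h3 := (le_abs_self _).trans (hbound ε hε y₀ hy)
      linarith
  refine tendsto_lambdaMax fun i j => ?_
  have hzero : Tendsto (fun ε => pd2 u₀ (xε ε) i j - pd2 (uε ε) (xε ε) i j) (𝓝[>] 0) (𝓝 0) := by
    refine squeeze_zero_norm' (a := fun ε => 16 * exp 2 * η ε / ρ ^ 2) ?_
      (by simpa using (hηlim.const_mul (16 * exp 2)).div_const (ρ ^ 2))
    filter_upwards [hsmall, hxlim.eventually (ball_mem_nhds y₀ hρ)] with ε hε hxρ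
    have hsub : ball (xε ε) ρ ⊆ ball y₀ (2 * ρ) :=
      ball_subset_ball' (by linarith [mem_ball.1 hxρ])
    have hcd₀ : ∀ x ∈ ball (xε ε) ρ, ContDiffAt ℝ 2 u₀ x := fun x hx =>
      h₀.2.1 x (hmem ε hε x (hsub hx)).1
    have hcd : ∀ x ∈ ball (xε ε) ρ, ContDiffAt ℝ 2 (uε ε) x := fun x hx =>
      (huε ε (hI ε hε)).2.1 x (hmem ε hε x (hsub hx))
    rw [← pd2_sub (hcd₀ _ (mem_ball_self hρ)) (hcd _ (mem_ball_self hρ)), Real.norm_eq_abs]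
    refine abs_pd2_le_of_lap_eq_zero hρ (hηpos ε hε) (fun x hx => (hcd₀ x hx).sub (hcd x hx))
      (fun x hx => ?_) (fun x hx => hbound ε hε x (hsub hx)) i j
    have hxU := hmem ε hε x (hsub hx)
    rw [lap_sub (hcd₀ x hx) (hcd x hx), h₀.2.2.1 x hxU.1, (huε ε (hI ε hε)).2.2.1 x hxU, sub_self]
  have hlim := ((continuousAt_pd2 hu₀ i j).tendsto.comp hxlim).sub hzero
  simpa [Hess] using hlim
end
end

section
/- There exist constants C > 0 and ε₀ > 0 such that for all ε ∈ (0, ε₀) and all x ∈ Ω_ε, the harmonic function v_ε satisfies |v_ε(x) + (2π/log ε)·(1 − 2π H(x₀)/log ε)·G(x)| ≤ C/(log ε)². -/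
open Real Set Metric Filter Topology

noncomputable section

/-- The pure second partial derivative is the second derivative along a coordinate line. -/
lemma pd2_self_eq_iteratedDeriv {u : E2 → ℝ} {x : E2} (hu : ContDiffAt ℝ 2 u x) (i : Fin 2) :
    pd2 u x i i = iteratedDeriv 2 (fun t : ℝ => u (x + t • EuclideanSpace.single i (1 : ℝ))) 0 := by
  set e : E2 := EuclideanSpace.single i (1 : ℝ)
  have hline : ∀ t : ℝ, HasDerivAt (fun t : ℝ => x + t • e) e t := fun t => by
    simpa using ((hasDerivAt_id t).smul_const e).const_add x
  have hcont : Tendsto (fun t : ℝ => x + t • e) (𝓝 0) (𝓝 x) := by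
    simpa using (hline 0).continuousAt.tendsto
  have hdiff : ∀ᶠ y in 𝓝 x, DifferentiableAt ℝ u y :=
    (hu.eventually (by simp)).mono fun y hy => hy.differentiableAt (by simp)
  have hderiv : deriv (fun t : ℝ => u (x + t • e)) =ᶠ[𝓝 0] fun t => fderiv ℝ u (x + t • e) e := by
    filter_upwards [hcont.eventually hdiff] with t ht
    exact (ht.hasFDerivAt.comp_hasDerivAt t (hline t)).deriv
  have hfd : DifferentiableAt ℝ (fun y => fderiv ℝ u y e) x :=
    ((hu.fderiv_right (m := 1) (by norm_num)).differentiableAt (by simp)).clm_apply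
      (differentiableAt_const e)
  have hfd' : HasFDerivAt (fun y => fderiv ℝ u y e) (fderiv ℝ (fun y => fderiv ℝ u y e) x)
      (x + (0 : ℝ) • e) := by
    simpa using hfd.hasFDerivAt
  rw [iteratedDeriv_succ, iteratedDeriv_one, hderiv.deriv_eq]
  exact (hfd'.comp_hasDerivAt 0 (hline 0)).deriv.symm

lemma contDiffAt_comp_line {u : E2 → ℝ} {x : E2} (hu : ContDiffAt ℝ 2 u x) (e : E2) :
    ContDiffAt ℝ 2 (fun t : ℝ => u (x + t • e)) 0 := by
  have hl : ContDiffAt ℝ 2 (fun t : ℝ => x + t • e) 0 := by fun_prop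
  exact ContDiffAt.comp (0 : ℝ) (g := u) (by simpa using hu) hl

lemma pd2_self_add {u v : E2 → ℝ} {x : E2} (hu : ContDiffAt ℝ 2 u x) (hv : ContDiffAt ℝ 2 v x)
    (i : Fin 2) : pd2 (fun y => u y + v y) x i i = pd2 u x i i + pd2 v x i i := by
  rw [pd2_self_eq_iteratedDeriv hu, pd2_self_eq_iteratedDeriv hv,
    pd2_self_eq_iteratedDeriv (hu.add hv)]
  exact iteratedDeriv_fun_add (contDiffAt_comp_line hu _) (contDiffAt_comp_line hv _)

lemma iteratedDeriv_two_nonpos_of_isLocalMax {f : ℝ → ℝ} {a : ℝ} (hf : ContinuousAt f a)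
    (hmax : IsLocalMax f a) : iteratedDeriv 2 f a ≤ 0 := by
  rw [iteratedDeriv_succ, iteratedDeriv_one]
  by_contra! hpos
  have hmin := isLocalMin_of_deriv_deriv_pos hpos hmax.deriv_eq_zero hf
  have hconst : f =ᶠ[𝓝 a] fun _ => f a := by
    filter_upwards [hmax, hmin] with y h₁ h₂ using le_antisymm h₁ h₂
  have hderiv : deriv f =ᶠ[𝓝 a] fun _ => 0 :=
    hconst.deriv.trans (Eventually.of_forall fun y => by simp)
  rw [hderiv.deriv_eq] at hpos
  simp at hpos

lemma lap_nonpos_of_isLocalMax {u : E2 → ℝ} {x : E2} (hu : ContDiffAt ℝ 2 u x)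
    (hmax : IsLocalMax u x) : lap u x ≤ 0 := by
  have h : ∀ i, pd2 u x i i ≤ 0 := fun i => by
    rw [pd2_self_eq_iteratedDeriv hu]
    have hl : ContinuousAt (fun t : ℝ => x + t • EuclideanSpace.single i (1 : ℝ)) 0 := by fun_prop
    refine iteratedDeriv_two_nonpos_of_isLocalMax (contDiffAt_comp_line hu _).continuousAt ?_
    have ht : Tendsto (fun t : ℝ => x + t • EuclideanSpace.single i (1 : ℝ)) (𝓝 0) (𝓝 x) := by
      simpa using hl.tendsto
    filter_upwards [ht.eventually hmax] with t h
    simpa using h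
  exact add_nonpos (h 0) (h 1)

lemma lap_norm_sq (x : E2) : lap (fun y => ‖y‖ ^ 2) x = 4 := by
  have h : ∀ i, pd2 (fun y : E2 => ‖y‖ ^ 2) x i i = 2 := fun i => by
    rw [pd2_self_eq_iteratedDeriv (contDiff_norm_sq ℝ).contDiffAt]
    have hexp : (fun t : ℝ => ‖x + t • EuclideanSpace.single i (1 : ℝ)‖ ^ 2) =
        fun t => ‖x‖ ^ 2 + 2 * x i * t + t ^ 2 := by
      funext t
      fin_cases i <;> simp [EuclideanSpace.norm_sq_eq, Fin.sum_univ_two] <;> ring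
    have h₁ : deriv (fun t : ℝ => ‖x‖ ^ 2 + 2 * x i * t + t ^ 2) = fun t => 2 * x i + 2 * t := by
      funext t
      have : HasDerivAt (fun t : ℝ => ‖x‖ ^ 2 + 2 * x i * t + t ^ 2) (2 * x i + 2 * t) t := by
        simpa using (((hasDerivAt_id' t).const_mul (2 * x i)).const_add (‖x‖ ^ 2)).fun_add
          ((hasDerivAt_id' t).fun_pow 2)
      exact this.deriv
    rw [hexp, iteratedDeriv_succ, iteratedDeriv_one, h₁]
    simp
  rw [lap, h, h]
  norm_num

/-- Weak maximum principle for subharmonic functions on a bounded open set. -/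
lemma le_of_lap_nonneg_of_le_frontier {U : Set E2} (hUo : IsOpen U) (hUb : Bornology.IsBounded U)
    {w : E2 → ℝ} (hcont : ContinuousOn w (closure U)) (hC2 : ∀ x ∈ U, ContDiffAt ℝ 2 w x)
    (hlap : ∀ x ∈ U, 0 ≤ lap w x) {M : ℝ} (hM : ∀ x ∈ frontier U, w x ≤ M) :
    ∀ x ∈ U, w x ≤ M := by
  intro x hx
  by_contra! hlt
  obtain ⟨R, hR0, hR⟩ := hUb.closure.exists_pos_norm_le
  set δ := (w x - M) / (2 * R ^ 2) with hδ
  have hδ0 : 0 < δ := by have := sub_pos.2 hlt; positivity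
  have hδR : δ * R ^ 2 = (w x - M) / 2 := by rw [hδ]; field_simp
  have hsq : ∀ y : E2, ContDiffAt ℝ 2 (fun y : E2 => ‖y‖ ^ 2) y :=
    fun y => (contDiff_norm_sq ℝ).contDiffAt
  obtain ⟨z, hz, hzmax⟩ := hUb.isCompact_closure.exists_isMaxOn ⟨x, subset_closure hx⟩
    (f := fun y => w y + δ * ‖y‖ ^ 2) (hcont.add (by fun_prop))
  by_cases hzU : z ∈ U
  · have hmax : IsLocalMax (fun y => w y + δ * ‖y‖ ^ 2) z :=
      hzmax.isLocalMax (mem_of_superset (hUo.mem_nhds hzU) subset_closure)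
    have h := lap_nonpos_of_isLocalMax ((hC2 z hzU).add (contDiffAt_const.mul (hsq z))) hmax
    rw [lap_add (hC2 z hzU) (contDiffAt_const.mul (hsq z)), lap_const_mul (hsq z),
      lap_norm_sq] at h
    linarith [hlap z hzU]
  · have h₁ := hM z ⟨hz, by rwa [hUo.interior_eq]⟩
    have h₂ : w x + δ * ‖x‖ ^ 2 ≤ w z + δ * ‖z‖ ^ 2 := hzmax (subset_closure hx)
    have h₃ : δ * ‖z‖ ^ 2 ≤ δ * R ^ 2 := by gcongr; exact hR z hz
    have h₄ : 0 ≤ δ * ‖x‖ ^ 2 := by positivity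
    linarith

lemma abs_le_of_lap_eq_zero_of_abs_le_frontier {U : Set E2} (hUo : IsOpen U)
    (hUb : Bornology.IsBounded U) {w : E2 → ℝ} (hcont : ContinuousOn w (closure U))
    (hharm : ∀ x ∈ U, ContDiffAt ℝ 2 w x ∧ lap w x = 0) {M : ℝ}
    (hM : ∀ x ∈ frontier U, |w x| ≤ M) : ∀ x ∈ U, |w x| ≤ M := by
  intro x hx
  rw [abs_le']
  refine ⟨le_of_lap_nonneg_of_le_frontier hUo hUb hcont (fun y hy => (hharm y hy).1)
    (fun y hy => (hharm y hy).2.ge) (fun y hy => (abs_le'.1 (hM y hy)).1) x hx, ?_⟩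
  have h := le_of_lap_nonneg_of_le_frontier hUo hUb (w := fun y => -1 * w y)
    (continuousOn_const.mul hcont) (fun y hy => contDiffAt_const.mul (hharm y hy).1)
    (fun y hy => by rw [lap_const_mul (hharm y hy).1, (hharm y hy).2, mul_zero])
    (M := M) (fun y hy => by simpa using (abs_le'.1 (hM y hy)).2) x hx
  simpa using h

lemma contDiffAt_log_norm_sub {x x₀ : E2} (hx : x ≠ x₀) :
    ContDiffAt ℝ 2 (fun y => Real.log ‖y - x₀‖) x :=
  ((contDiffAt_id.sub contDiffAt_const).norm ℝ (sub_ne_zero.2 hx)).log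
    (norm_ne_zero_iff.2 (sub_ne_zero.2 hx))

lemma iteratedDeriv_two_half_log_sq_add_sq {a b : ℝ} (h : a ^ 2 + b ^ 2 ≠ 0) :
    iteratedDeriv 2 (fun t : ℝ => 1 / 2 * Real.log ((a + t) ^ 2 + b ^ 2)) 0 =
      (b ^ 2 - a ^ 2) / (a ^ 2 + b ^ 2) ^ 2 := by
  have hq : ∀ t, HasDerivAt (fun t : ℝ => (a + t) ^ 2 + b ^ 2) (2 * (a + t)) t := fun t => by
    simpa using (((hasDerivAt_id t).const_add a).pow 2).add_const (b ^ 2)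
  have hne : ∀ᶠ t in 𝓝 (0 : ℝ), (a + t) ^ 2 + b ^ 2 ≠ 0 :=
    (hq 0).continuousAt.eventually_ne (by simpa using h)
  have h₁ : deriv (fun t : ℝ => 1 / 2 * Real.log ((a + t) ^ 2 + b ^ 2)) =ᶠ[𝓝 0]
      fun t => (a + t) / ((a + t) ^ 2 + b ^ 2) := by
    filter_upwards [hne] with t ht
    rw [(((hq t).log ht).const_mul (1 / 2)).deriv]
    ring
  rw [iteratedDeriv_succ, iteratedDeriv_one, h₁.deriv_eq]
  have h₂ := (((hasDerivAt_id (0 : ℝ)).const_add a).div (hq 0) (by simpa using h)).deriv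
  refine Eq.trans h₂ ?_
  simp only [id, add_zero]
  ring

lemma lap_log_norm_sub {x x₀ : E2} (hx : x ≠ x₀) :
    lap (fun y => Real.log ‖y - x₀‖) x = 0 := by
  have hnorm : ∀ y : E2, Real.log ‖y - x₀‖ =
      1 / 2 * Real.log ((y 0 - x₀ 0) ^ 2 + (y 1 - x₀ 1) ^ 2) := fun y => by
    have : (y 0 - x₀ 0) ^ 2 + (y 1 - x₀ 1) ^ 2 = ‖y - x₀‖ ^ 2 := by
      simp [EuclideanSpace.norm_sq_eq, Fin.sum_univ_two]
    rw [this, Real.log_pow]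
    push_cast
    ring
  have hne : (x 0 - x₀ 0) ^ 2 + (x 1 - x₀ 1) ^ 2 ≠ 0 := by
    have : (x 0 - x₀ 0) ^ 2 + (x 1 - x₀ 1) ^ 2 = ‖x - x₀‖ ^ 2 := by
      simp [EuclideanSpace.norm_sq_eq, Fin.sum_univ_two]
    rw [this]
    exact pow_ne_zero 2 (norm_ne_zero_iff.2 (sub_ne_zero.2 hx))
  have h₀ : pd2 (fun y => Real.log ‖y - x₀‖) x 0 0 =
      ((x 1 - x₀ 1) ^ 2 - (x 0 - x₀ 0) ^ 2) / ((x 0 - x₀ 0) ^ 2 + (x 1 - x₀ 1) ^ 2) ^ 2 := by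
    rw [pd2_self_eq_iteratedDeriv (contDiffAt_log_norm_sub hx),
      ← iteratedDeriv_two_half_log_sq_add_sq hne]
    congr 1
    funext t
    rw [hnorm]
    simp [add_sub_right_comm]
  have h₁ : pd2 (fun y => Real.log ‖y - x₀‖) x 1 1 =
      ((x 0 - x₀ 0) ^ 2 - (x 1 - x₀ 1) ^ 2) / ((x 1 - x₀ 1) ^ 2 + (x 0 - x₀ 0) ^ 2) ^ 2 := by
    rw [pd2_self_eq_iteratedDeriv (contDiffAt_log_norm_sub hx),
      ← iteratedDeriv_two_half_log_sq_add_sq (by rwa [add_comm])]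
    congr 1
    funext t
    rw [hnorm, add_comm ((_ : ℝ) ^ 2)]
    simp [add_sub_right_comm]
  rw [lap, h₀, h₁]
  ring

lemma frontier_diff_closedBall_subset {Ω : Set E2} (hΩo : IsOpen Ω) (x₀ : E2) (ε : ℝ) :
    frontier (Ω \ closedBall x₀ ε) ⊆ frontier Ω ∪ sphere x₀ ε := by
  rintro x ⟨hcl, hint⟩
  rw [(hΩo.sdiff isClosed_closedBall).interior_eq] at hint
  have hge : ε ≤ dist x x₀ := by
    refine closure_minimal ?_ (isClosed_le continuous_const (continuous_id.dist continuous_const))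
      hcl
    intro y hy
    exact (not_le.1 fun h => hy.2 (mem_closedBall.2 h)).le
  by_cases hx : x ∈ Ω
  · exact Or.inr (le_antisymm (by_contra fun h => hint ⟨hx, h⟩) hge)
  · exact Or.inl ⟨closure_mono sdiff_subset hcl, by rwa [hΩo.interior_eq]⟩

/-- The boundary error on the small circle, where `L = log ε`, `h = H x₀` and `k = H x`. -/
lemma abs_boundary_error_le {ε K h k : ℝ} (hε : 0 < ε) (hε' : ε < 1) (hK : 0 ≤ K)
    (hk : |k - h| ≤ K * ε) :
    |1 + (2 * π / Real.log ε) * (1 - 2 * π * h / Real.log ε) *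
        (-(1 / (2 * π)) * Real.log ε - k)| ≤
      (2 * π * K + 4 * π ^ 2 * ((|h| + K) * |h|)) / Real.log ε ^ 2 := by
  set L := Real.log ε with hL
  have hL0 : L ≠ 0 := (Real.log_neg hε hε').ne
  have hLε : |L * ε| ≤ 1 := (Real.abs_log_mul_self_lt ε hε hε'.le).le
  have hkb : |k| ≤ |h| + K := by
    calc |k| = |h + (k - h)| := by ring_nf
      _ ≤ |h| + |k - h| := abs_add_le _ _
      _ ≤ |h| + K := by nlinarith
  have hpi := Real.pi_pos
  have heq : 1 + (2 * π / L) * (1 - 2 * π * h / L) * (-(1 / (2 * π)) * L - k) =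
      (2 * π * ((h - k) * L) + 4 * π ^ 2 * (k * h)) / L ^ 2 := by
    field_simp
    ring
  rw [heq, abs_div, abs_of_nonneg (sq_nonneg L)]
  gcongr
  refine (abs_add_le _ _).trans ?_
  rw [abs_mul, abs_mul (4 * π ^ 2), abs_mul k, abs_of_pos (by positivity : 0 < 2 * π),
    abs_of_pos (by positivity : 0 < 4 * π ^ 2)]
  gcongr
  calc |(h - k) * L| = |k - h| * |L| := by rw [abs_mul, abs_sub_comm]
    _ ≤ K * ε * |L| := by gcongr
    _ = K * |L * ε| := by rw [abs_mul, abs_of_pos hε]; ring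
    _ ≤ K := by nlinarith

/-- Asymptotics of the harmonic function `v_ε` which is `0` on `∂Ω` and `1` on `∂B(x₀,ε)`:
`v_ε(x) = -(2π/log ε)(1 - 2πH(x₀)/log ε)·G(x,x₀) + O(1/(log ε)²)` uniformly on `Ω_ε`. -/
theorem harmonic_capacity_expansion
    (Ω : Set E2) (hΩo : IsOpen Ω) (hΩb : Bornology.IsBounded Ω) (hΩc : Convex ℝ Ω)
    (x₀ : E2) (hx₀ : x₀ ∈ Ω)
    (H G : E2 → ℝ)
    (hHharm : ∀ x ∈ Ω, ContDiffAt ℝ 2 H x ∧ lap H x = 0)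
    (hHcont : ContinuousOn H (closure Ω))
    (hHbd : ∀ x ∈ frontier Ω, H x = -(1 / (2 * π)) * Real.log ‖x - x₀‖)
    (hG : ∀ x, G x = -(1 / (2 * π)) * Real.log ‖x - x₀‖ - H x)
    (ε₁ : ℝ) (hε₁ : 0 < ε₁) (hball : closedBall x₀ ε₁ ⊆ Ω)
    (vε : ℝ → E2 → ℝ)
    (hvε : ∀ ε ∈ Ioo (0:ℝ) ε₁,
      ContinuousOn (vε ε) (closure (Ω \ closedBall x₀ ε)) ∧
      (∀ x ∈ Ω \ closedBall x₀ ε, ContDiffAt ℝ 2 (vε ε) x ∧ lap (vε ε) x = 0) ∧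
      (∀ x ∈ frontier Ω, vε ε x = 0) ∧
      (∀ x ∈ sphere x₀ ε, vε ε x = 1)) :
    ∃ C > 0, ∃ ε₀ > 0, ε₀ ≤ ε₁ ∧ ∀ ε ∈ Ioo (0:ℝ) ε₀, ∀ x ∈ Ω \ closedBall x₀ ε,
      |vε ε x + (2 * π / Real.log ε) * (1 - 2 * π * H x₀ / Real.log ε) * G x|
        ≤ C / (Real.log ε) ^ 2 := by
  have hbigO := ((hHharm x₀ hx₀).1.differentiableAt (by simp)).isBigO_sub
  obtain ⟨K, hK0, hK⟩ := hbigO.exists_pos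
  obtain ⟨r, hr0, hr⟩ := Metric.eventually_nhds_iff.1 hK.bound
  refine ⟨2 * π * K + 4 * π ^ 2 * ((|H x₀| + K) * |H x₀|), by positivity, min ε₁ (min r 1),
    by positivity, min_le_left _ _, ?_⟩
  rintro ε ⟨hε0, hεlt⟩
  simp only [lt_min_iff] at hεlt
  obtain ⟨hεε₁, hεr, hε1⟩ := hεlt
  obtain ⟨hvc, hvh, hv0, hv1⟩ := hvε ε ⟨hε0, hεε₁⟩
  set c := (2 * π / Real.log ε) * (1 - 2 * π * H x₀ / Real.log ε)
  have hne : ∀ x ∈ closure (Ω \ closedBall x₀ ε), x ≠ x₀ := by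
    rintro x hx rfl
    have hsub : Ω \ closedBall x ε ⊆ (ball x ε)ᶜ :=
      fun y hy h => hy.2 (ball_subset_closedBall h)
    exact closure_minimal hsub isOpen_ball.isClosed_compl hx (mem_ball_self hε0)
  have hGeq : G = fun x => -(1 / (2 * π)) * Real.log ‖x - x₀‖ + -1 * H x := by
    funext x
    rw [hG]
    ring
  have hGh : ∀ x ∈ Ω \ closedBall x₀ ε, ContDiffAt ℝ 2 G x ∧ lap G x = 0 := by
    intro x hx
    have hxne := hne x (subset_closure hx)
    have hlog := contDiffAt_log_norm_sub hxne
    obtain ⟨hHC, hHl⟩ := hHharm x hx.1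
    rw [hGeq]
    refine ⟨(contDiffAt_const.mul hlog).add (contDiffAt_const.mul hHC), ?_⟩
    rw [lap_add (contDiffAt_const.mul hlog) (contDiffAt_const.mul hHC), lap_const_mul hlog,
      lap_const_mul hHC, lap_log_norm_sub hxne, hHl]
    ring
  have hGc : ContinuousOn G (closure (Ω \ closedBall x₀ ε)) := by
    rw [hGeq]
    refine (continuousOn_const.mul fun x hx => ?_).add
      (continuousOn_const.mul (hHcont.mono (closure_mono sdiff_subset)))
    exact (contDiffAt_log_norm_sub (hne x hx)).continuousAt.continuousWithinAt
  refine abs_le_of_lap_eq_zero_of_abs_le_frontier (w := fun x => vε ε x + c * G x)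
    (hΩo.sdiff isClosed_closedBall) (hΩb.subset sdiff_subset)
    (hvc.add (continuousOn_const.mul hGc)) ?_ ?_
  · intro x hx
    obtain ⟨hvC, hvl⟩ := hvh x hx
    obtain ⟨hGC, hGl⟩ := hGh x hx
    refine ⟨hvC.add (contDiffAt_const.mul hGC), ?_⟩
    rw [lap_add hvC (contDiffAt_const.mul hGC), lap_const_mul hGC, hvl, hGl]
    ring
  · intro x hx
    rcases frontier_diff_closedBall_subset hΩo x₀ ε hx with hx | hx
    · have hG0 : G x = 0 := by rw [hG, hHbd x hx, sub_self]
      simp only [hv0 x hx, hG0, mul_zero, add_zero, abs_zero]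
      positivity
    · have hnorm : ‖x - x₀‖ = ε := by rw [← dist_eq_norm]; exact hx
      have hHx : |H x - H x₀| ≤ K * ε := by
        have h := hr (y := x) (by rw [mem_sphere.1 hx]; exact hεr)
        rwa [Real.norm_eq_abs, hnorm] at h
      simp only [hv1 x hx, hG, hnorm]
      exact abs_boundary_error_le hε0 hε1 hK0.le hHx
end
end

section
/- For every compact set K ⊂ Ω \ {x₀} there exist constants C > 0 and ε₀ > 0 such that for all ε ∈ (0, ε₀) and all x ∈ K, |u_ε(x) − u₀(x)| + |∇u_ε(x) − ∇u₀(x)| + ‖D²u_ε(x) − D²u₀(x)‖ ≤ C/|log ε|. In particular, u_ε → u₀ in the C²-topology on compact subsets of Ω \ {x₀} as ε → 0⁺. -/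
open Real Set Metric Filter Topology

noncomputable section

/-- The `ℓ¹`-norm of a 2×2 matrix (a norm on 2×2 matrices). -/
noncomputable def matAbs (M : Matrix (Fin 2) (Fin 2) ℝ) : ℝ := ∑ i : Fin 2, ∑ j : Fin 2, |M i j|

open InnerProductSpace

/-- The standard isometry from `ℂ` to the Euclidean plane. -/
def planeIso : ℂ ≃ₗᵢ[ℝ] E2 := Complex.orthonormalBasisOneI.repr

lemma planeIso_one : planeIso 1 = EuclideanSpace.single 0 1 := by
  ext i; fin_cases i <;> simp [planeIso, Complex.orthonormalBasisOneI_repr_apply]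

lemma planeIso_I : planeIso Complex.I = EuclideanSpace.single 1 1 := by
  ext i; fin_cases i <;> simp [planeIso, Complex.orthonormalBasisOneI_repr_apply]

lemma ContDiffAt.differentiableAt_fderiv_two {f : E2 → ℝ} {x : E2} (hf : ContDiffAt ℝ 2 f x) :
    DifferentiableAt ℝ (fderiv ℝ f) x :=
  (hf.fderiv_right (m := 1) (by norm_num)).differentiableAt (by norm_num)

lemma pd2_eq {f : E2 → ℝ} {x : E2} (hf : ContDiffAt ℝ 2 f x) (i j : Fin 2) :
    pd2 f x i j = fderiv ℝ (fderiv ℝ f) x (EuclideanSpace.single i 1)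
      (EuclideanSpace.single j 1) := by
  rw [pd2, fderiv_clm_apply hf.differentiableAt_fderiv_two (by fun_prop)]
  simp

lemma pd2_sub_s5 {f g : E2 → ℝ} {x : E2} (hf : ContDiffAt ℝ 2 f x) (hg : ContDiffAt ℝ 2 g x)
    (i j : Fin 2) : pd2 (f - g) x i j = pd2 f x i j - pd2 g x i j := by
  rw [pd2_eq hf, pd2_eq hg, pd2_eq (show ContDiffAt ℝ 2 (f - g) x from hf.sub hg)]
  have h : fderiv ℝ (f - g) =ᶠ[𝓝 x] fderiv ℝ f - fderiv ℝ g := by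
    filter_upwards [hf.eventually (by simp), hg.eventually (by simp)] with y hfy hgy
    simp [fderiv_sub (hfy.differentiableAt (by simp)) (hgy.differentiableAt (by simp))]
  rw [h.fderiv_eq, fderiv_sub hf.differentiableAt_fderiv_two hg.differentiableAt_fderiv_two]
  simp

lemma harmonicAt_comp_planeIso {f : E2 → ℝ} {U : Set E2} (hU : IsOpen U)
    (hf : ∀ x ∈ U, ContDiffAt ℝ 2 f x) (hl : ∀ x ∈ U, lap f x = 0) {z : ℂ}
    (hz : planeIso z ∈ U) : HarmonicAt (f ∘ planeIso) z := by
  refine ⟨(hf _ hz).comp z planeIso.contDiff.contDiffAt, ?_⟩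
  filter_upwards [(hU.preimage planeIso.continuous).mem_nhds hz] with y hy
  have key : iteratedFDeriv ℝ 2 (f ∘ planeIso) y =
      (iteratedFDeriv ℝ 2 f (planeIso y)).compContinuousLinearMap
        fun _ => (planeIso.toContinuousLinearEquiv : ℂ →L[ℝ] E2) := by
    simp only [← iteratedFDerivWithin_univ]
    exact planeIso.toContinuousLinearEquiv.iteratedFDerivWithin_comp_right f uniqueDiffOn_univ
        (x := y) (mem_univ _) 2
  have h := hl _ hy
  rw [lap, pd2_eq (hf _ hy), pd2_eq (hf _ hy)] at h
  rw [laplacian_eq_iteratedFDeriv_complexPlane]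
  simpa [key, iteratedFDeriv_two_apply, planeIso_one, planeIso_I] using h

/-- The weak maximum principle for harmonic functions on bounded planar open sets. -/
lemma nonpos_of_harmonicOnNhd {f : ℂ → ℝ} {U : Set ℂ} (hU : IsOpen U)
    (hb : Bornology.IsBounded U) (hc : ContinuousOn f (closure U))
    (hf : HarmonicOnNhd f U) (hfr : ∀ z ∈ frontier U, f z ≤ 0) {z : ℂ} (hz : z ∈ closure U) :
    f z ≤ 0 := by
  have hcpt : IsCompact (closure U) := hb.isCompact_closure
  obtain ⟨m, hm, hmax⟩ := hcpt.exists_isMaxOn ⟨z, hz⟩ hc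
  have hScpt : IsCompact (closure U ∩ f ⁻¹' {f m}) :=
    hcpt.of_isClosed_subset (hc.preimage_isClosed_of_isClosed hcpt.isClosed isClosed_singleton)
      inter_subset_left
  obtain ⟨p, ⟨hpU, hpm⟩, hp⟩ :=
    hScpt.exists_isMaxOn ⟨m, hm, rfl⟩ Complex.continuous_re.continuousOn
  have hpm : f p = f m := hpm
  refine (hmax hz).trans ?_
  change f m ≤ 0
  rw [← hpm]
  by_cases hpin : p ∈ U
  swap
  · exact hfr p ⟨hpU, by rwa [hU.interior_eq]⟩
  exfalso
  obtain ⟨r, hr, hball⟩ := Metric.isOpen_iff.1 hU p hpin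
  obtain ⟨F, hF, hFf⟩ := HarmonicOnNhd.exists_analyticOnNhd_ball_re_eq
    (fun y hy => hf y (hball hy) : HarmonicOnNhd f (ball p r))
  have hnorm : ∀ y ∈ ball p r, ‖Complex.exp (F y)‖ = Real.exp (f y) := fun y hy => by
    rw [Complex.norm_exp, ← hFf hy]
  have hloc : ∀ᶠ y in 𝓝 p, Complex.exp (F y) = Complex.exp (F p) := by
    apply Complex.eventually_eq_of_isLocalMax_norm (f := fun y => Complex.exp (F y))
    · filter_upwards [ball_mem_nhds p hr] with y hy
      exact (hF y hy).differentiableAt.cexp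
    · filter_upwards [ball_mem_nhds p hr] with y hy
      simp only [Function.comp_apply, hnorm y hy, hnorm p (mem_ball_self hr), Real.exp_le_exp, hpm]
      exact hmax (subset_closure (hball hy))
  obtain ⟨s, hs, hs'⟩ := Metric.eventually_nhds_iff_ball.1
    (hloc.and (ball_mem_nhds p hr))
  have hq : p + (s / 2 : ℝ) ∈ ball p s := by
    simp only [mem_ball, dist_self_add_left, Complex.norm_real, Real.norm_eq_abs]
    rw [abs_of_pos (by positivity)]; linarith
  obtain ⟨h1, h2⟩ := hs' _ hq
  have hfq : f (p + (s / 2 : ℝ)) = f m := by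
    have := congrArg norm h1
    rw [hnorm _ h2, hnorm p (mem_ball_self hr), Real.exp_eq_exp] at this
    rw [this, hpm]
  have := hp ⟨subset_closure (hball h2), hfq⟩
  simp only [mem_ofPred_eq, Complex.add_re, Complex.ofReal_re] at this
  linarith

/-- A holomorphic function whose real part is bounded by `A` on a ball has derivative at most
`e² A / R` at the centre. -/
lemma norm_deriv_le_of_abs_re_le {F : ℂ → ℂ} {c : ℂ} {R A : ℝ} (hR : 0 < R) (hA : 0 < A)
    (hF : AnalyticOnNhd ℂ F (closedBall c R)) (hre : ∀ z ∈ closedBall c R, |(F z).re| ≤ A) :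
    ‖deriv F c‖ ≤ A * Real.exp 2 / R := by
  have hc : c ∈ closedBall c R := mem_closedBall_self hR.le
  have hd : DifferentiableOn ℂ (fun z => Complex.exp (F z / A)) (closedBall c R) :=
    (hF.differentiableOn.div_const _).cexp
  have hre' : ∀ z, (F z / A).re = (F z).re / A := fun z => Complex.div_ofReal_re _ _
  have h1 : ‖deriv (fun z => Complex.exp (F z / A)) c‖ ≤ Real.exp 1 / R := by
    refine Complex.norm_deriv_le_of_forall_mem_sphere_norm_le hR (hd.diffContOnCl_ball le_rfl) ?_
    intro z hz
    rw [Complex.norm_exp, Real.exp_le_exp, hre', div_le_one hA]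
    exact (abs_le.1 (hre z (sphere_subset_closedBall hz))).2
  have h2 : deriv (fun z => Complex.exp (F z / A)) c = Complex.exp (F c / A) * (deriv F c / A) :=
    ((hF c hc).differentiableAt.hasDerivAt.div_const _).cexp.deriv
  have h3 : Real.exp (-1) ≤ ‖Complex.exp (F c / A)‖ := by
    rw [Complex.norm_exp, Real.exp_le_exp, hre', le_div_iff₀ hA]
    linarith [(abs_le.1 (hre c hc)).1]
  rw [h2, norm_mul, norm_div, Complex.norm_real, Real.norm_eq_abs, abs_of_pos hA] at h1
  have h4 : Real.exp (-1) * (‖deriv F c‖ / A) ≤ Real.exp 1 / R :=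
    (mul_le_mul_of_nonneg_right h3 (by positivity)).trans h1
  have h5 : ‖deriv F c‖ = A * Real.exp 1 * (Real.exp (-1) * (‖deriv F c‖ / A)) := by
    have : Real.exp 1 * Real.exp (-1) = 1 := by rw [← Real.exp_add]; simp
    field_simp
    linear_combination (-‖deriv F c‖) * this
  rw [h5]
  calc _ ≤ A * Real.exp 1 * (Real.exp 1 / R) := by gcongr
    _ = _ := by rw [show (2:ℝ) = 1 + 1 by norm_num, Real.exp_add]; ring

/-- Interior estimates for the first two derivatives of a harmonic function in the plane. -/
lemma norm_fderiv_le_and_abs_pd2_le {w : E2 → ℝ} {x : E2} {R A : ℝ} (hR : 0 < R) (hA : 0 < A)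
    (hw : ∀ y ∈ ball x R, ContDiffAt ℝ 2 w y) (hl : ∀ y ∈ ball x R, lap w y = 0)
    (hb : ∀ y ∈ ball x R, |w y| ≤ A) :
    ‖fderiv ℝ w x‖ ≤ 4 * A * Real.exp 2 / R ∧
      ∀ i j, |pd2 w x i j| ≤ 16 * A * Real.exp 2 / R ^ 2 := by
  set c : ℂ := planeIso.symm x with hcdef
  have hxc : planeIso c = x := planeIso.apply_symm_apply x
  have hmem : ∀ z, z ∈ ball c R → planeIso z ∈ ball x R := fun z hz => by
    rw [mem_ball, ← hxc, planeIso.dist_map]; exact hz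
  have hmem' : ∀ y, y ∈ ball x R → planeIso.symm y ∈ ball c R := fun y hy => by
    rw [mem_ball, hcdef, planeIso.symm.dist_map]; exact hy
  obtain ⟨F, hF, hFw⟩ := HarmonicOnNhd.exists_analyticOnNhd_ball_re_eq
    (fun z hz => harmonicAt_comp_planeIso isOpen_ball hw hl (hmem z hz) :
      HarmonicOnNhd (w ∘ planeIso) (ball c R))
  have hderiv : ∀ z ∈ closedBall c (R / 4), ‖deriv F z‖ ≤ 4 * A * Real.exp 2 / R := by
    intro z hz
    have hsub : closedBall z (R / 4) ⊆ ball c R := fun y hy => by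
      rw [mem_ball]
      rw [mem_closedBall] at hy hz
      linarith [dist_triangle y z c]
    refine (norm_deriv_le_of_abs_re_le (by positivity : 0 < R / 4) hA (hF.mono hsub) ?_).trans_eq
      (by field_simp)
    intro y hy
    have := hFw (hsub hy)
    simp only [Function.comp_apply] at this
    rw [this]
    exact hb _ (hmem y (hsub hy))
  have hsub : closedBall c (R / 4) ⊆ ball c R := closedBall_subset_ball (by linarith)
  have hc : c ∈ closedBall c (R / 4) := mem_closedBall_self (by positivity)
  have hderiv2 : ‖deriv (deriv F) c‖ ≤ 16 * A * Real.exp 2 / R ^ 2 := by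
    refine (Complex.norm_deriv_le_of_forall_mem_sphere_norm_le (by positivity : 0 < R / 4)
      ((hF.deriv.mono hsub).differentiableOn.diffContOnCl_ball le_rfl)
      fun z hz => hderiv z (sphere_subset_closedBall hz)).trans_eq ?_
    field_simp
    norm_num
  let L : E2 →L[ℝ] ℂ := (planeIso.symm.toContinuousLinearEquiv : E2 →L[ℝ] ℂ)
  have hL : ∀ y, L y = planeIso.symm y := fun _ => rfl
  have hLn : ∀ y, ‖L y‖ = ‖y‖ := fun y => planeIso.symm.norm_map y
  have hderivComp : ∀ (G : ℂ → ℂ) (a : ℂ) (y : E2), DifferentiableAt ℂ G (L y) →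
      HasFDerivAt (fun y => (a * G (L y)).re)
        (Complex.reCLM.comp ((a * deriv G (L y)) • L))
        y := by
    intro G a y hG
    have h1 := (hG.hasDerivAt.hasFDerivAt.restrictScalars ℝ).comp y L.hasFDerivAt
    have h2 := Complex.reCLM.hasFDerivAt.comp y (h1.const_mul a)
    refine h2.congr_fderiv ?_
    ext v
    simp
    ring
  have hw' : ∀ y ∈ ball x R, ∀ v, fderiv ℝ w y v = (L v * deriv F (L y)).re := by
    intro y hy v
    have heq : w =ᶠ[𝓝 y] fun y => (1 * F (L y)).re := by
      filter_upwards [isOpen_ball.mem_nhds hy] with u hu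
      have := hFw (hmem' u hu)
      simpa [hL] using this.symm
    rw [heq.fderiv_eq, (hderivComp F 1 y (hF _ (hmem' y hy)).differentiableAt).fderiv]
    simp
    ring
  have hx : x ∈ ball x R := mem_ball_self hR
  constructor
  · refine ContinuousLinearMap.opNorm_le_bound _ (by positivity) fun v => ?_
    rw [hw' x hx, Real.norm_eq_abs]
    refine (Complex.abs_re_le_norm _).trans ?_
    rw [norm_mul, hLn, mul_comm]
    exact mul_le_mul_of_nonneg_right (hderiv c hc) (norm_nonneg _)
  · intro i j
    rw [pd2]
    have heq : (fun y => fderiv ℝ w y (EuclideanSpace.single j 1)) =ᶠ[𝓝 x]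
        fun y => (L (EuclideanSpace.single j 1) * deriv F (L y)).re := by
      filter_upwards [isOpen_ball.mem_nhds hx] with y hy using hw' y hy _
    rw [heq.fderiv_eq, (hderivComp (deriv F) _ x (hF.deriv _ (hmem' x hx)).differentiableAt).fderiv]
    simp only [ContinuousLinearMap.comp_apply, _root_.smul_apply, smul_eq_mul,
      Complex.reCLM_apply]
    refine (Complex.abs_re_le_norm _).trans ?_
    rw [norm_mul, norm_mul, hLn, hLn]
    simpa [hL] using hderiv2

/-- Comparison of a harmonic function with a multiple of the fundamental solution. -/
lemma abs_le_mul_log_sub_log {h : ℂ → ℝ} {U : Set ℂ} {c : ℂ} {κ B : ℝ} (hU : IsOpen U)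
    (hb : Bornology.IsBounded U) (hcU : c ∉ closure U) (hc : ContinuousOn h (closure U))
    (hh : HarmonicOnNhd h U) (hfr : ∀ z ∈ frontier U, |h z| ≤ κ * (B - Real.log ‖z - c‖))
    {z : ℂ} (hz : z ∈ closure U) : |h z| ≤ κ * (B - Real.log ‖z - c‖) := by
  have hne : ∀ y ∈ closure U, y - c ≠ 0 := fun y hy hyc => hcU (sub_eq_zero.1 hyc ▸ hy)
  have hbc : ContinuousOn (fun z => κ * (B - Real.log ‖z - c‖)) (closure U) :=
    continuousOn_const.mul (continuousOn_const.sub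
      ((by fun_prop : ContinuousOn (fun z => ‖z - c‖) (closure U)).log
        fun y hy => norm_ne_zero_iff.2 (hne y hy)))
  have hbh : HarmonicOnNhd (fun z => κ * (B - Real.log ‖z - c‖)) U := fun y hy =>
    ((harmonicAt_const B).sub (AnalyticAt.harmonicAt_log_norm (f := fun z => z - c) (by fun_prop)
      (hne y (subset_closure hy)))).const_smul
  have upper := nonpos_of_harmonicOnNhd hU hb (hc.sub hbc) (hh.sub hbh)
    (fun y hy => sub_nonpos.2 (abs_le.1 (hfr y hy)).2) hz
  have lower := nonpos_of_harmonicOnNhd hU hb (hc.neg.sub hbc) (hh.neg.sub hbh)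
    (fun y hy => sub_nonpos.2 (by simpa using neg_le.1 (abs_le.1 (hfr y hy)).1)) hz
  rw [abs_le']
  exact ⟨sub_nonpos.1 upper, sub_nonpos.1 lower⟩

lemma IsTorsion.lap_sub_eq_zero {U V : Set E2} {u v : E2 → ℝ} (hu : IsTorsion U u)
    (hv : IsTorsion V v) {y : E2} (hyU : y ∈ U) (hyV : y ∈ V) : lap (u - v) y = 0 := by
  have h1 := hu.2.2.1 y hyU
  have h2 := hv.2.2.1 y hyV
  simp only [lap] at h1 h2 ⊢
  rw [pd2_sub_s5 (hu.2.1 y hyU) (hv.2.1 y hyV), pd2_sub_s5 (hu.2.1 y hyU) (hv.2.1 y hyV)]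
  linarith

/-- Making a small hole perturbs the torsion function by at most a multiple of the fundamental
solution, normalised at the boundary of the hole. -/
lemma IsTorsion.abs_sub_le {Ω : Set E2} (hΩo : IsOpen Ω) (hΩb : Bornology.IsBounded Ω)
    {u₀ u : E2 → ℝ} (h₀ : IsTorsion Ω u₀) {x₀ : E2} {ε M D : ℝ} (hε : 0 < ε) (hεD : ε < D)
    (hu : IsTorsion (Ω \ closedBall x₀ ε) u)
    (hM : ∀ x ∈ closure Ω, |u₀ x| ≤ M) (hD : ∀ x ∈ closure Ω, dist x x₀ ≤ D)
    {x : E2} (hx : x ∈ Ω \ closedBall x₀ ε) :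
    |u x - u₀ x| ≤
      M / (Real.log D - Real.log ε) * (Real.log D - Real.log (dist x x₀)) := by
  set V := Ω \ closedBall x₀ ε with hV
  have hVo : IsOpen V := hΩo.sdiff isClosed_closedBall
  have hVcl : closure V ⊆ closure Ω := closure_mono sdiff_subset
  have hdist : ∀ y ∈ closure V, ε ≤ dist y x₀ := fun y hy =>
    closure_minimal (s := V) (t := {y | ε ≤ dist y x₀})
      (fun v hv => le_of_not_ge fun h => hv.2 (mem_closedBall.2 h))
      (isClosed_le continuous_const (by fun_prop)) hy
  have hlog : 0 < Real.log D - Real.log ε := sub_pos.2 (Real.log_lt_log hε hεD)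
  have hM0 : 0 ≤ M := (abs_nonneg _).trans (hM x (subset_closure hx.1))
  have hnorm : ∀ z : ℂ, ‖z - planeIso.symm x₀‖ = dist (planeIso z) x₀ := fun z => by
    rw [← dist_eq_norm, ← planeIso.dist_map, planeIso.apply_symm_apply]
  have hcl : closure (planeIso ⁻¹' V) = planeIso ⁻¹' closure V :=
    (planeIso.toHomeomorph.preimage_closure V).symm
  have hfrt : frontier (planeIso ⁻¹' V) = planeIso ⁻¹' frontier V :=
    (planeIso.toHomeomorph.preimage_frontier V).symm
  have hC2 : ∀ y ∈ V, ContDiffAt ℝ 2 (u - u₀) y := fun y hy =>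
    (hu.2.1 y hy).sub (h₀.2.1 y hy.1)
  have hlap : ∀ y ∈ V, lap (u - u₀) y = 0 := fun y hy => hu.lap_sub_eq_zero h₀ hy hy.1
  have hcont : ContinuousOn ((u - u₀) ∘ planeIso) (closure (planeIso ⁻¹' V)) := by
    rw [hcl]
    exact (hu.1.sub (h₀.1.mono hVcl)).comp planeIso.continuous.continuousOn fun _ h => h
  have hfr : ∀ y ∈ frontier V, |u y - u₀ y| ≤
      M / (Real.log D - Real.log ε) * (Real.log D - Real.log (dist y x₀)) := by
    intro y hy
    have hycl : y ∈ closure V := frontier_subset_closure hy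
    have hyd := hdist y hycl
    rw [hu.2.2.2 y hy]
    by_cases hyb : y ∈ closedBall x₀ ε
    · rw [le_antisymm hyb hyd, div_mul_cancel₀ _ hlog.ne', zero_sub, abs_neg]
      exact hM y (hVcl hycl)
    · have hyΩ : y ∈ frontier Ω := by
        refine ⟨hVcl hycl, ?_⟩
        rw [hΩo.interior_eq]
        intro h
        exact hy.2 (by rw [hVo.interior_eq]; exact ⟨h, hyb⟩)
      rw [h₀.2.2.2 y hyΩ, sub_zero, abs_zero]
      exact mul_nonneg (div_nonneg hM0 hlog.le)
        (sub_nonneg.2 (Real.log_le_log (hε.trans_le hyd) (hD y (hVcl hycl))))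
  have key := abs_le_mul_log_sub_log (h := (u - u₀) ∘ planeIso) (c := planeIso.symm x₀)
    (κ := M / (Real.log D - Real.log ε)) (B := Real.log D) (hVo.preimage planeIso.continuous)
    (planeIso.antilipschitz.isBounded_preimage (hΩb.subset sdiff_subset))
    (by
      rw [hcl, mem_preimage, planeIso.apply_symm_apply]
      intro h
      have := hdist _ h
      rw [dist_self] at this
      linarith)
    hcont (fun z hz => harmonicAt_comp_planeIso hVo hC2 hlap hz)
    (fun z hz => by
      rw [hnorm]
      rw [hfrt] at hz
      exact hfr _ hz)
    (z := planeIso.symm x) (by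
      rw [hcl, mem_preimage, planeIso.apply_symm_apply]; exact subset_closure hx)
  rw [hnorm] at key
  simpa using key

/-- `u_ε → u₀` in `C²` on compact subsets of `Ω \ {x₀}`, with rate `C/|log ε|`. -/
theorem C2_convergence_away_from_hole
    (Ω : Set E2) (hΩo : IsOpen Ω) (hΩb : Bornology.IsBounded Ω) (hΩc : Convex ℝ Ω)
    (u₀ : E2 → ℝ) (h₀ : IsTorsion Ω u₀)
    (x₀ : E2) (hx₀ : x₀ ∈ Ω)
    (ε₁ : ℝ) (hε₁ : 0 < ε₁) (hball : closedBall x₀ ε₁ ⊆ Ω)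
    (uε : ℝ → E2 → ℝ)
    (huε : ∀ ε ∈ Ioo (0:ℝ) ε₁, IsTorsion (Ω \ closedBall x₀ ε) (uε ε))
    (K : Set E2) (hK : IsCompact K) (hKΩ : K ⊆ Ω \ {x₀}) :
    ∃ C > 0, ∃ ε₀ > 0, ε₀ ≤ ε₁ ∧ ∀ ε ∈ Ioo (0:ℝ) ε₀, ∀ x ∈ K,
      |uε ε x - u₀ x| + ‖gradient (uε ε) x - gradient u₀ x‖
          + matAbs (Hess (uε ε) x - Hess u₀ x)
        ≤ C / |Real.log ε| := by
  have hcpt : IsCompact (closure Ω) := hΩb.isCompact_closure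
  obtain ⟨M', hM'⟩ := hcpt.exists_bound_of_continuousOn h₀.1
  obtain ⟨D', hD'⟩ := (isBounded_iff_subset_closedBall x₀).1 hcpt.isBounded
  set M := max M' 1
  set D := max D' 1
  have hM : ∀ x ∈ closure Ω, |u₀ x| ≤ M := fun x hx => (hM' x hx).trans (le_max_left _ _)
  have hD : ∀ x ∈ closure Ω, dist x x₀ ≤ D := fun x hx => (hD' hx).trans (le_max_left _ _)
  have hM0 : 0 < M := zero_lt_one.trans_le (le_max_right _ _)
  have hD1 : 1 ≤ D := le_max_right _ _
  obtain ⟨δ, hδ, hδK⟩ := hK.exists_thickening_subset_open (hΩo.sdiff isClosed_singleton) hKΩ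
  set r := min (δ / 2) (1 / 2)
  have hr : 0 < r := lt_min (by positivity) (by norm_num)
  have hrδ : r ≤ δ / 2 := min_le_left _ _
  have hr1 : r ≤ 1 / 2 := min_le_right _ _
  have hKδ : ∀ x ∈ K, ball x δ ⊆ Ω \ {x₀} := fun x hx =>
    (ball_subset_thickening hx δ).trans hδK
  have hKr : ∀ x ∈ K, ∀ y ∈ ball x r, y ∈ Ω ∧ r ≤ dist y x₀ := by
    intro x hx y hy
    rw [mem_ball] at hy
    refine ⟨(hKδ x hx (by rw [mem_ball]; linarith)).1, ?_⟩
    by_contra! hlt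
    have : x₀ ∈ ball x δ := by
      rw [mem_ball]
      linarith [dist_triangle x₀ y x, dist_comm x₀ y]
    exact (hKδ x hx this).2 rfl
  set S := M * (Real.log D - Real.log r)
  have hS : 0 < S := mul_pos hM0 (sub_pos.2 (Real.log_lt_log hr (by linarith)))
  refine ⟨S * (1 + 4 * Real.exp 2 / r + 4 * (16 * Real.exp 2 / r ^ 2)), by positivity,
    min ε₁ r, lt_min hε₁ hr, min_le_left _ _, ?_⟩
  rintro ε ⟨hε, hεlt⟩ x hx
  have hεε₁ : ε < ε₁ := hεlt.trans_le (min_le_left _ _)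
  have hεr : ε < r := hεlt.trans_le (min_le_right _ _)
  have hT := huε ε ⟨hε, hεε₁⟩
  have hlogε : 0 < |Real.log ε| := abs_pos.2 (Real.log_neg hε (by linarith)).ne
  have hlogle : |Real.log ε| ≤ Real.log D - Real.log ε := by
    rw [abs_of_neg (Real.log_neg hε (by linarith))]
    linarith [Real.log_nonneg hD1]
  have hmem : ∀ y ∈ ball x r, y ∈ Ω \ closedBall x₀ ε := fun y hy =>
    ⟨(hKr x hx y hy).1, fun h => by linarith [(hKr x hx y hy).2, mem_closedBall.1 h]⟩
  have hbound : ∀ y ∈ ball x r, |(uε ε - u₀) y| ≤ S / |Real.log ε| := by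
    intro y hy
    have hry := (hKr x hx y hy).2
    refine (h₀.abs_sub_le hΩo hΩb hε (by linarith : ε < D)
      hT hM hD (hmem y hy)).trans ?_
    rw [div_mul_eq_mul_div]
    have : Real.log r ≤ Real.log (dist y x₀) := Real.log_le_log hr hry
    gcongr
    exact mul_le_mul_of_nonneg_left (by linarith) hM0.le
  have hC2 : ∀ y ∈ ball x r, ContDiffAt ℝ 2 (uε ε - u₀) y := fun y hy =>
    (hT.2.1 y (hmem y hy)).sub (h₀.2.1 y (hmem y hy).1)
  have hlap : ∀ y ∈ ball x r, lap (uε ε - u₀) y = 0 := fun y hy =>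
    hT.lap_sub_eq_zero h₀ (hmem y hy) (hmem y hy).1
  obtain ⟨hgrad, hhess⟩ :=
    norm_fderiv_le_and_abs_pd2_le hr (div_pos hS hlogε) hC2 hlap hbound
  have hxr : x ∈ ball x r := mem_ball_self hr
  have hux := hT.2.1 x (hmem x hxr)
  have hu₀x := h₀.2.1 x (hmem x hxr).1
  have hgradeq : ‖gradient (uε ε) x - gradient u₀ x‖ = ‖fderiv ℝ (uε ε - u₀) x‖ := by
    rw [gradient, gradient, ← map_sub, LinearIsometryEquiv.norm_map,
      fderiv_sub (hux.differentiableAt (by simp)) (hu₀x.differentiableAt (by simp))]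
  have hhesseq : ∀ i j, (Hess (uε ε) x - Hess u₀ x) i j = pd2 (uε ε - u₀) x i j := fun i j => by
    rw [pd2_sub_s5 hux hu₀x]; rfl
  have hmat : matAbs (Hess (uε ε) x - Hess u₀ x) ≤
      4 * (16 * (S / |Real.log ε|) * Real.exp 2 / r ^ 2) := by
    simp only [matAbs, hhesseq, Fin.sum_univ_two]
    linarith [hhess 0 0, hhess 0 1, hhess 1 0, hhess 1 1]
  rw [hgradeq]
  calc _ ≤ S / |Real.log ε| + 4 * (S / |Real.log ε|) * Real.exp 2 / r +
        4 * (16 * (S / |Real.log ε|) * Real.exp 2 / r ^ 2) :=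
        add_le_add (add_le_add (hbound x hxr) hgrad) hmat
    _ = _ := by ring
end
end

section
/- Define, for ε > 0 with B̄(x₀, ε) ⊂ Ω and w ∈ ℝ² with |w| > 1, K_ε(w) = −u₀(x₀ + ε w/|w|²) + (ε²/2)·(1 − 1/|w|²). Then there exist constants C > 0 and ε₀ > 0 such that for all ε ∈ (0, ε₀) and all w with |w| > 1: |∇_w K_ε(w)| ≤ C·ε/|w|² and ‖D²_w K_ε(w)‖ ≤ C·ε/|w|³. -/
open Real Set Metric Filter Topology

noncomputable section

/-- `K_ε(w) = -u₀(x₀ + εw/|w|²) + (ε²/2)(1 - 1/|w|²)`. -/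
noncomputable def Kfun (u₀ : E2 → ℝ) (x₀ : E2) (ε : ℝ) (w : E2) : ℝ :=
  -u₀ (x₀ + (ε / ‖w‖ ^ 2) • w) + (ε ^ 2 / 2) * (1 - 1 / ‖w‖ ^ 2)

section Inversion

variable {E : Type*} [NormedAddCommGroup E] [InnerProductSpace ℝ E]

lemma hasFDerivAt_inv_norm_sq {w : E} (hw : w ≠ 0) :
    HasFDerivAt (fun y : E => (‖y‖ ^ 2)⁻¹) ((-2 * ((‖w‖ ^ 2)⁻¹) ^ 2) • innerSL ℝ w) w := by
  have hn : ‖w‖ ^ 2 ≠ 0 := pow_ne_zero 2 (norm_ne_zero_iff.2 hw)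
  have h := (hasDerivAt_inv hn).comp_hasFDerivAt w (hasStrictFDerivAt_norm_sq w).hasFDerivAt
  refine h.congr_fderiv ?_
  ext a
  simp
  field_simp

/-- The derivative of the inversion `y ↦ y / ‖y‖²`. -/
def inversionDeriv (w : E) : E →L[ℝ] E :=
  (‖w‖ ^ 2)⁻¹ • ContinuousLinearMap.id ℝ E +
    ((-2 * ((‖w‖ ^ 2)⁻¹) ^ 2) • innerSL ℝ w).smulRight w

lemma inversionDeriv_apply (w v : E) :
    inversionDeriv w v =
      (‖w‖ ^ 2)⁻¹ • v + (-2 * ((‖w‖ ^ 2)⁻¹) ^ 2 * inner ℝ w v) • w := by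
  simp [inversionDeriv]

lemma hasFDerivAt_inversion {w : E} (hw : w ≠ 0) :
    HasFDerivAt (fun y : E => (‖y‖ ^ 2)⁻¹ • y) (inversionDeriv w) w :=
  (hasFDerivAt_inv_norm_sq hw).smul (hasFDerivAt_id w)

/-- The derivative of `y ↦ ⟪y, v⟫ / ‖y‖⁴`. -/
def innerDivDeriv (w v : E) : E →L[ℝ] ℝ :=
  ((‖w‖ ^ 2)⁻¹) ^ 2 • innerSL ℝ v +
    (-4 * ((‖w‖ ^ 2)⁻¹) ^ 3 * inner ℝ w v) • innerSL ℝ w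

lemma hasFDerivAt_innerDiv {w : E} (hw : w ≠ 0) (v : E) :
    HasFDerivAt (fun y : E => ((‖y‖ ^ 2)⁻¹) ^ 2 * inner ℝ y v) (innerDivDeriv w v) w := by
  have h1 := (hasFDerivAt_inv_norm_sq hw).pow 2
  have h2 : HasFDerivAt (fun y : E => inner ℝ y v) (innerSL ℝ v) w := by
    refine (innerSL ℝ v).hasFDerivAt.congr_of_eventuallyEq (Eventually.of_forall fun y => ?_)
    simp [real_inner_comm]
  refine (h1.mul h2).congr_fderiv ?_
  ext a
  simp [innerDivDeriv]
  ring

/-- The derivative of `y ↦ inversionDeriv y v`. -/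
def inversionDerivTwo (w v : E) : E →L[ℝ] E :=
  ((-2 * ((‖w‖ ^ 2)⁻¹) ^ 2) • innerSL ℝ w).smulRight v +
    ((-2 * (((‖w‖ ^ 2)⁻¹) ^ 2 * inner ℝ w v)) • ContinuousLinearMap.id ℝ E +
      ((-2 : ℝ) • innerDivDeriv w v).smulRight w)

lemma hasFDerivAt_inversionDeriv {w : E} (hw : w ≠ 0) (v : E) :
    HasFDerivAt (fun y : E => inversionDeriv y v) (inversionDerivTwo w v) w := by
  have h := ((hasFDerivAt_inv_norm_sq hw).smul_const v).add
    (((hasFDerivAt_innerDiv hw v).const_mul (-2)).smul (hasFDerivAt_id w))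
  refine h.congr_of_eventuallyEq (Eventually.of_forall fun y => ?_)
  simp [inversionDeriv_apply, mul_assoc]

lemma norm_inversionDeriv_apply_le {w : E} (hw : w ≠ 0) (v : E) :
    ‖inversionDeriv w v‖ ≤ 3 * ‖w‖⁻¹ ^ 2 * ‖v‖ := by
  have hn : ‖w‖ ≠ 0 := norm_ne_zero_iff.2 hw
  rw [inversionDeriv_apply]
  calc _ ≤ ‖(‖w‖ ^ 2)⁻¹ • v‖ + ‖(-2 * ((‖w‖ ^ 2)⁻¹) ^ 2 * inner ℝ w v) • w‖ := norm_add_le _ _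
    _ = (‖w‖ ^ 2)⁻¹ * ‖v‖ + 2 * ((‖w‖ ^ 2)⁻¹) ^ 2 * ‖inner ℝ w v‖ * ‖w‖ := by
      simp [norm_smul]
    _ ≤ (‖w‖ ^ 2)⁻¹ * ‖v‖ + 2 * ((‖w‖ ^ 2)⁻¹) ^ 2 * (‖w‖ * ‖v‖) * ‖w‖ := by
      gcongr
      exact norm_inner_le_norm w v
    _ = 3 * ‖w‖⁻¹ ^ 2 * ‖v‖ := by field_simp; ring

lemma norm_innerDivDeriv_apply_le {w : E} (hw : w ≠ 0) (v a : E) :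
    ‖innerDivDeriv w v a‖ ≤ 5 * ‖w‖⁻¹ ^ 4 * ‖v‖ * ‖a‖ := by
  have hn : ‖w‖ ≠ 0 := norm_ne_zero_iff.2 hw
  calc _ = ‖((‖w‖ ^ 2)⁻¹) ^ 2 * inner ℝ v a +
        (-4 * ((‖w‖ ^ 2)⁻¹) ^ 3 * inner ℝ w v) * inner ℝ w a‖ := by simp [innerDivDeriv]
    _ ≤ ‖((‖w‖ ^ 2)⁻¹) ^ 2 * inner ℝ v a‖ +
        ‖(-4 * ((‖w‖ ^ 2)⁻¹) ^ 3 * inner ℝ w v) * inner ℝ w a‖ := norm_add_le _ _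
    _ = ((‖w‖ ^ 2)⁻¹) ^ 2 * ‖inner ℝ v a‖ +
        4 * ((‖w‖ ^ 2)⁻¹) ^ 3 * ‖inner ℝ w v‖ * ‖inner ℝ w a‖ := by
      simp
    _ ≤ ((‖w‖ ^ 2)⁻¹) ^ 2 * (‖v‖ * ‖a‖) +
        4 * ((‖w‖ ^ 2)⁻¹) ^ 3 * (‖w‖ * ‖v‖) * (‖w‖ * ‖a‖) := by
      gcongr <;> exact norm_inner_le_norm _ _
    _ = 5 * ‖w‖⁻¹ ^ 4 * ‖v‖ * ‖a‖ := by field_simp; ring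

lemma norm_inversionDerivTwo_apply_le {w : E} (hw : w ≠ 0) (v a : E) :
    ‖inversionDerivTwo w v a‖ ≤ 14 * ‖w‖⁻¹ ^ 3 * ‖v‖ * ‖a‖ := by
  have hn : ‖w‖ ≠ 0 := norm_ne_zero_iff.2 hw
  calc
    _ = ‖(-2 * ((‖w‖ ^ 2)⁻¹) ^ 2 * inner ℝ w a) • v +
        ((-2 * (((‖w‖ ^ 2)⁻¹) ^ 2 * inner ℝ w v)) • a + (-2 * innerDivDeriv w v a) • w)‖ := by
      simp [inversionDerivTwo]
    _ ≤ ‖(-2 * ((‖w‖ ^ 2)⁻¹) ^ 2 * inner ℝ w a) • v‖ +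
        (‖(-2 * (((‖w‖ ^ 2)⁻¹) ^ 2 * inner ℝ w v)) • a‖ + ‖(-2 * innerDivDeriv w v a) • w‖) :=
      (norm_add_le _ _).trans (add_le_add_right (norm_add_le _ _) _)
    _ = 2 * ((‖w‖ ^ 2)⁻¹) ^ 2 * ‖inner ℝ w a‖ * ‖v‖ +
        (2 * (((‖w‖ ^ 2)⁻¹) ^ 2 * ‖(inner ℝ w v : ℝ)‖) * ‖a‖ +
          2 * ‖innerDivDeriv w v a‖ * ‖w‖) := by
      simp [norm_smul]
    _ ≤ 2 * ((‖w‖ ^ 2)⁻¹) ^ 2 * (‖w‖ * ‖a‖) * ‖v‖ +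
        (2 * (((‖w‖ ^ 2)⁻¹) ^ 2 * (‖w‖ * ‖v‖)) * ‖a‖ +
          2 * (5 * ‖w‖⁻¹ ^ 4 * ‖v‖ * ‖a‖) * ‖w‖) := by
      gcongr
      · exact norm_inner_le_norm _ _
      · exact norm_inner_le_norm _ _
      · exact norm_innerDivDeriv_apply_le hw v a
    _ = 14 * ‖w‖⁻¹ ^ 3 * ‖v‖ * ‖a‖ := by field_simp; ring

end Inversion

lemma norm_gradient_eq_norm_fderiv {F : Type*} [NormedAddCommGroup F] [InnerProductSpace ℝ F]
    [CompleteSpace F] (f : F → ℝ) (x : F) : ‖gradient f x‖ = ‖fderiv ℝ f x‖ := by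
  simp [gradient]

lemma hasFDerivAt_scaled_inversion (x₀ : E2) (ε : ℝ) {w : E2} (hw : w ≠ 0) :
    HasFDerivAt (fun y : E2 => x₀ + (ε / ‖y‖ ^ 2) • y) (ε • inversionDeriv w) w := by
  refine (((hasFDerivAt_inversion hw).const_smul ε).const_add x₀).congr_of_eventuallyEq
    (Eventually.of_forall fun y => ?_)
  simp [div_eq_mul_inv, smul_smul]

lemma hasFDerivAt_Kfun {u : E2 → ℝ} {x₀ : E2} {ε : ℝ} {w : E2} (hw : w ≠ 0)
    (hu : DifferentiableAt ℝ u (x₀ + (ε / ‖w‖ ^ 2) • w)) :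
    HasFDerivAt (Kfun u x₀ ε)
      (-((fderiv ℝ u (x₀ + (ε / ‖w‖ ^ 2) • w)).comp (ε • inversionDeriv w)) +
        (ε ^ 2 * ((‖w‖ ^ 2)⁻¹) ^ 2) • innerSL ℝ w) w := by
  have h := (hu.hasFDerivAt.comp w (hasFDerivAt_scaled_inversion x₀ ε hw)).neg.add
    (((hasFDerivAt_inv_norm_sq hw).const_sub 1).const_mul (ε ^ 2 / 2))
  refine (h.congr_of_eventuallyEq (Eventually.of_forall fun y => ?_)).congr_fderiv ?_
  · simp [Kfun]
  · ext a
    simp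
    ring

lemma fderiv_Kfun_apply {u : E2 → ℝ} {x₀ : E2} {ε : ℝ} {w : E2} (hw : w ≠ 0)
    (hu : DifferentiableAt ℝ u (x₀ + (ε / ‖w‖ ^ 2) • w)) (v : E2) :
    fderiv ℝ (Kfun u x₀ ε) w v =
      -(ε * fderiv ℝ u (x₀ + (ε / ‖w‖ ^ 2) • w) (inversionDeriv w v)) +
        ε ^ 2 * (((‖w‖ ^ 2)⁻¹) ^ 2 * inner ℝ w v) := by
  rw [(hasFDerivAt_Kfun hw hu).fderiv]
  simp [mul_assoc]

lemma fderiv_fderiv_Kfun_apply {u : E2 → ℝ} {x₀ : E2} {ε : ℝ} {w : E2} (hw : w ≠ 0)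
    (hu : ContDiffAt ℝ 2 u (x₀ + (ε / ‖w‖ ^ 2) • w)) (v a : E2) :
    fderiv ℝ (fun y => fderiv ℝ (Kfun u x₀ ε) y v) w a =
      -(ε * (ε * fderiv ℝ (fderiv ℝ u) (x₀ + (ε / ‖w‖ ^ 2) • w) (inversionDeriv w a)
          (inversionDeriv w v) +
        fderiv ℝ u (x₀ + (ε / ‖w‖ ^ 2) • w) (inversionDerivTwo w v a))) +
        ε ^ 2 * innerDivDeriv w v a := by
  have hF := hasFDerivAt_scaled_inversion x₀ ε hw
  have hd : DifferentiableAt ℝ (fderiv ℝ u) (x₀ + (ε / ‖w‖ ^ 2) • w) :=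
    (hu.fderiv_right (m := 1) (by norm_num)).differentiableAt (by norm_num)
  have hev : ∀ᶠ y in 𝓝 w, DifferentiableAt ℝ u (x₀ + (ε / ‖y‖ ^ 2) • y) :=
    hF.continuousAt.eventually <| (hu.eventually (by simp)).mono fun z hz =>
      hz.differentiableAt (by norm_num)
  have h := ((((hd.hasFDerivAt.comp w hF).clm_apply
    (hasFDerivAt_inversionDeriv hw v)).const_mul ε).neg).add
    ((hasFDerivAt_innerDiv hw v).const_mul (ε ^ 2))
  have heq := (hev.and (isOpen_ne.mem_nhds hw)).mono fun y hy => fderiv_Kfun_apply hy.2 hy.1 v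
  rw [(h.congr_of_eventuallyEq heq).fderiv]
  simp
  ring

lemma norm_fderiv_Kfun_le {u : E2 → ℝ} {x₀ : E2} {ε M : ℝ} {w : E2} (hε : ε ∈ Ioo (0 : ℝ) 1)
    (hw : 1 < ‖w‖) (hu : DifferentiableAt ℝ u (x₀ + (ε / ‖w‖ ^ 2) • w)) (hM0 : 0 ≤ M)
    (hM : ‖fderiv ℝ u (x₀ + (ε / ‖w‖ ^ 2) • w)‖ ≤ M) :
    ‖fderiv ℝ (Kfun u x₀ ε) w‖ ≤ (3 * M + 1) * ε / ‖w‖ ^ 2 := by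
  obtain ⟨hε0, hε1⟩ := hε
  have hn : 0 < ‖w‖ := one_pos.trans hw
  have hw0 : w ≠ 0 := norm_pos_iff.1 hn
  have ht : ‖w‖⁻¹ ≤ 1 := inv_le_one_of_one_le₀ hw.le
  refine ContinuousLinearMap.opNorm_le_bound _ (by positivity) fun v => ?_
  rw [fderiv_Kfun_apply hw0 hu]
  set L := fderiv ℝ u (x₀ + (ε / ‖w‖ ^ 2) • w)
  calc _ ≤ ‖-(ε * L (inversionDeriv w v))‖ + ‖ε ^ 2 * (((‖w‖ ^ 2)⁻¹) ^ 2 * inner ℝ w v)‖ :=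
        norm_add_le _ _
    _ = ε * ‖L (inversionDeriv w v)‖ + ε * ε * (((‖w‖ ^ 2)⁻¹) ^ 2 * ‖inner ℝ w v‖) := by
      simp only [norm_neg, norm_mul, norm_pow, norm_inv, norm_norm, Real.norm_of_nonneg hε0.le]
      ring
    _ ≤ ε * (M * (3 * ‖w‖⁻¹ ^ 2 * ‖v‖)) + ε * 1 * (((‖w‖ ^ 2)⁻¹) ^ 2 * (‖w‖ * ‖v‖)) := by
      gcongr
      · exact L.le_of_opNorm_le_of_le hM (norm_inversionDeriv_apply_le hw0 v)
      · exact norm_inner_le_norm _ _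
    _ = ε * (M * (3 * ‖w‖⁻¹ ^ 2 * ‖v‖)) + ε * ‖w‖⁻¹ ^ 2 * ‖v‖ * ‖w‖⁻¹ := by field_simp
    _ ≤ ε * (M * (3 * ‖w‖⁻¹ ^ 2 * ‖v‖)) + ε * ‖w‖⁻¹ ^ 2 * ‖v‖ * 1 := by gcongr
    _ = (3 * M + 1) * ε / ‖w‖ ^ 2 * ‖v‖ := by field_simp

lemma abs_fderiv_fderiv_Kfun_le {u : E2 → ℝ} {x₀ : E2} {ε M N : ℝ} {w : E2}
    (hε : ε ∈ Ioo (0 : ℝ) 1) (hw : 1 < ‖w‖)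
    (hu : ContDiffAt ℝ 2 u (x₀ + (ε / ‖w‖ ^ 2) • w)) (hN0 : 0 ≤ N)
    (hM : ‖fderiv ℝ u (x₀ + (ε / ‖w‖ ^ 2) • w)‖ ≤ M)
    (hN : ‖fderiv ℝ (fderiv ℝ u) (x₀ + (ε / ‖w‖ ^ 2) • w)‖ ≤ N) (v a : E2) :
    |fderiv ℝ (fun y => fderiv ℝ (Kfun u x₀ ε) y v) w a| ≤
      (9 * N + 14 * M + 5) * ε / ‖w‖ ^ 3 * ‖v‖ * ‖a‖ := by
  obtain ⟨hε0, hε1⟩ := hε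
  have hn : 0 < ‖w‖ := one_pos.trans hw
  have hw0 : w ≠ 0 := norm_pos_iff.1 hn
  have ht : ‖w‖⁻¹ ≤ 1 := inv_le_one_of_one_le₀ hw.le
  rw [fderiv_fderiv_Kfun_apply hw0 hu]
  set L := fderiv ℝ u (x₀ + (ε / ‖w‖ ^ 2) • w)
  set B := fderiv ℝ (fderiv ℝ u) (x₀ + (ε / ‖w‖ ^ 2) • w)
  have hB : ‖B (inversionDeriv w a) (inversionDeriv w v)‖ ≤
      N * (3 * ‖w‖⁻¹ ^ 2 * ‖a‖) * (3 * ‖w‖⁻¹ ^ 2 * ‖v‖) :=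
    (B _).le_of_opNorm_le_of_le (B.le_of_opNorm_le_of_le hN (norm_inversionDeriv_apply_le hw0 a))
      (norm_inversionDeriv_apply_le hw0 v)
  rw [← Real.norm_eq_abs]
  calc _ ≤ ‖ε * (ε * B (inversionDeriv w a) (inversionDeriv w v) + L (inversionDerivTwo w v a))‖ +
        ‖ε ^ 2 * innerDivDeriv w v a‖ := (norm_add_le _ _).trans_eq (by rw [norm_neg])
    _ ≤ ε * (ε * ‖B (inversionDeriv w a) (inversionDeriv w v)‖ + ‖L (inversionDerivTwo w v a)‖) +
        ε * ε * ‖innerDivDeriv w v a‖ := by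
      rw [norm_mul, norm_mul, norm_pow, Real.norm_of_nonneg hε0.le, sq]
      gcongr
      exact (norm_add_le _ _).trans_eq (by rw [norm_mul, Real.norm_of_nonneg hε0.le])
    _ ≤ ε * (1 * (N * (3 * ‖w‖⁻¹ ^ 2 * ‖a‖) * (3 * ‖w‖⁻¹ ^ 2 * ‖v‖)) +
          M * (14 * ‖w‖⁻¹ ^ 3 * ‖v‖ * ‖a‖)) +
        ε * 1 * (5 * ‖w‖⁻¹ ^ 4 * ‖v‖ * ‖a‖) := by
      gcongr
      · exact L.le_of_opNorm_le_of_le hM (norm_inversionDerivTwo_apply_le hw0 v a)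
      · exact norm_innerDivDeriv_apply_le hw0 v a
    _ = ε * M * 14 * ‖w‖⁻¹ ^ 3 * ‖v‖ * ‖a‖ +
        (9 * N + 5) * ε * ‖w‖⁻¹ ^ 3 * ‖v‖ * ‖a‖ * ‖w‖⁻¹ := by ring
    _ ≤ ε * M * 14 * ‖w‖⁻¹ ^ 3 * ‖v‖ * ‖a‖ +
        (9 * N + 5) * ε * ‖w‖⁻¹ ^ 3 * ‖v‖ * ‖a‖ * 1 := by gcongr
    _ = (9 * N + 14 * M + 5) * ε / ‖w‖ ^ 3 * ‖v‖ * ‖a‖ := by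
      rw [div_eq_mul_inv, inv_pow]; ring

lemma matAbs_le {M : Matrix (Fin 2) (Fin 2) ℝ} {c : ℝ} (h : ∀ i j, |M i j| ≤ c) :
    matAbs M ≤ 4 * c := by
  simp only [matAbs, Fin.sum_univ_two]
  linarith [h 0 0, h 0 1, h 1 0, h 1 1]

/-- Derivative estimates for `K_ε`: `|∇_w K_ε(w)| ≤ Cε/|w|²` and `‖D²_w K_ε(w)‖ ≤ Cε/|w|³`
for `|w| > 1`. -/
theorem Kfun_derivative_bounds
    (Ω : Set E2) (hΩo : IsOpen Ω) (hΩb : Bornology.IsBounded Ω) (hΩc : Convex ℝ Ω)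
    (u₀ : E2 → ℝ) (h₀ : IsTorsion Ω u₀)
    (x₀ : E2) (hx₀ : x₀ ∈ Ω)
    (ε₁ : ℝ) (hε₁ : 0 < ε₁) (hball : closedBall x₀ ε₁ ⊆ Ω) :
    ∃ C > 0, ∃ ε₀ > 0, ε₀ ≤ ε₁ ∧ ∀ ε ∈ Ioo (0:ℝ) ε₀, ∀ w : E2, 1 < ‖w‖ →
      ‖gradient (Kfun u₀ x₀ ε) w‖ ≤ C * ε / ‖w‖ ^ 2 ∧
      matAbs (Hess (Kfun u₀ x₀ ε) w) ≤ C * ε / ‖w‖ ^ 3 := by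
  have hsmooth : ∀ x ∈ closedBall x₀ ε₁, ContDiffAt ℝ 2 u₀ x := fun x hx => h₀.2.1 x (hball hx)
  have hderiv : ∀ x ∈ closedBall x₀ ε₁, ContDiffAt ℝ 1 (fderiv ℝ u₀) x := fun x hx =>
    (hsmooth x hx).fderiv_right (by norm_num)
  obtain ⟨M, hM⟩ := (isCompact_closedBall x₀ ε₁).exists_bound_of_continuousOn
    (f := fderiv ℝ u₀) fun x hx => (hderiv x hx).continuousAt.continuousWithinAt
  obtain ⟨N, hN⟩ := (isCompact_closedBall x₀ ε₁).exists_bound_of_continuousOn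
    (f := fderiv ℝ (fderiv ℝ u₀)) fun x hx =>
      ((hderiv x hx).fderiv_right (m := 0) (by norm_num)).continuousAt.continuousWithinAt
  have hcenter : x₀ ∈ closedBall x₀ ε₁ := mem_closedBall_self hε₁.le
  have hM0 : 0 ≤ M := (norm_nonneg _).trans (hM x₀ hcenter)
  have hN0 : 0 ≤ N := (norm_nonneg _).trans (hN x₀ hcenter)
  refine ⟨4 * (9 * N + 14 * M + 5), by positivity, min ε₁ 1, by positivity, min_le_left _ _, ?_⟩
  intro ε hε w hw
  have hε0 : 0 < ε := hε.1
  have hεlt : ε < ε₁ ∧ ε < 1 := lt_min_iff.1 hε.2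
  have hn : 0 < ‖w‖ := one_pos.trans hw
  have hmem : x₀ + (ε / ‖w‖ ^ 2) • w ∈ closedBall x₀ ε₁ := by
    rw [mem_closedBall, dist_self_add_left, norm_smul, Real.norm_of_nonneg (by positivity)]
    calc ε / ‖w‖ ^ 2 * ‖w‖ = ε / ‖w‖ := by field_simp
      _ ≤ ε := div_le_self hε0.le hw.le
      _ ≤ ε₁ := hεlt.1.le
  constructor
  · rw [norm_gradient_eq_norm_fderiv]
    refine (norm_fderiv_Kfun_le ⟨hε0, hεlt.2⟩ hw
      ((hsmooth _ hmem).differentiableAt (by norm_num)) hM0 (hM _ hmem)).trans ?_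
    gcongr
    linarith
  · have h : ∀ i j, |Hess (Kfun u₀ x₀ ε) w i j| ≤ (9 * N + 14 * M + 5) * ε / ‖w‖ ^ 3 := by
      intro i j
      simpa [Hess, pd2] using abs_fderiv_fderiv_Kfun_le ⟨hε0, hεlt.2⟩ hw (hsmooth _ hmem) hN0 (hM _ hmem)
        (hN _ hmem) (EuclideanSpace.single j 1) (EuclideanSpace.single i 1)
    exact (matAbs_le h).trans_eq (by ring)
end
end
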